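/- arXiv:1712.06805 — 5 statements merged into one kernel-verified Lean document; each statement's English description precedes it below -/
import Mathlib

section
/- The sequence n ↦ μ_n(𝒜,𝒝)^{1/n} converges as n → ∞, and its limit equals inf_{n ≥ 1} μ_n(𝒜,𝒝)^{1/n}. -/
open Filter

/-- The product `A_n B_n ⋯ A_1 B_1` of the first `n` pairs of factors of two
sequences of matrices (the pair with index `i`, `1 ≤ i ≤ n`, being `A (i-1) * B (i-1)`). -/
def prodAB {N M : ℕ} (A : ℕ → Matrix (Fin N) (Fin M) ℝ)
    (B : ℕ → Matrix (Fin M) (Fin N) ℝ) : ℕ → Matrix (Fin N) (Fin N) ℝ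
  | 0 => 1
  | n + 1 => (A n * B n) * prodAB A B n

/-- The product `A_n B_n ⋯ A_1 B_1` for collections of matrices indexed by `Fin n`. -/
def prodABFin {N M n : ℕ} (A : Fin n → Matrix (Fin N) (Fin M) ℝ)
    (B : Fin n → Matrix (Fin M) (Fin N) ℝ) : Matrix (Fin N) (Fin N) ℝ :=
  (List.ofFn fun i => A i * B i).reverse.prod

/-- `μ_n(𝒜,𝒝)`: the max over all choices `A_1,…,A_n ∈ 𝒜` of the min over all
choices `B_1,…,B_n ∈ 𝒝` of `ν (A_n B_n ⋯ A_1 B_1)`, where `ν` is a norm on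
`N×N` matrices. -/
noncomputable def muN {N M : ℕ} (𝒜 : Finset (Matrix (Fin N) (Fin M) ℝ))
    (𝒝 : Finset (Matrix (Fin M) (Fin N) ℝ)) (hA : 𝒜.Nonempty) (hB : 𝒝.Nonempty)
    (ν : Matrix (Fin N) (Fin N) ℝ → ℝ) (n : ℕ) : ℝ :=
  haveI : Nonempty {A // A ∈ 𝒜} := ⟨⟨hA.choose, hA.choose_spec⟩⟩
  haveI : Nonempty {B // B ∈ 𝒝} := ⟨⟨hB.choose, hB.choose_spec⟩⟩
  Finset.univ.sup' Finset.univ_nonempty fun A : Fin n → {A // A ∈ 𝒜} =>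
    Finset.univ.inf' Finset.univ_nonempty fun B : Fin n → {B // B ∈ 𝒝} =>
      ν (prodABFin (fun i => (A i : Matrix (Fin N) (Fin M) ℝ))
          (fun i => (B i : Matrix (Fin M) (Fin N) ℝ)))

/-- `η_n(𝒜,𝒝)`: the min over all choices `B_1,…,B_n ∈ 𝒝` of the max over all
choices `A_1,…,A_n ∈ 𝒜` of `ν (A_n B_n ⋯ A_1 B_1)`, where `ν` is a norm on
`N×N` matrices. -/
noncomputable def etaN {N M : ℕ} (𝒜 : Finset (Matrix (Fin N) (Fin M) ℝ))
    (𝒝 : Finset (Matrix (Fin M) (Fin N) ℝ)) (hA : 𝒜.Nonempty) (hB : 𝒝.Nonempty)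
    (ν : Matrix (Fin N) (Fin N) ℝ → ℝ) (n : ℕ) : ℝ :=
  haveI : Nonempty {A // A ∈ 𝒜} := ⟨⟨hA.choose, hA.choose_spec⟩⟩
  haveI : Nonempty {B // B ∈ 𝒝} := ⟨⟨hB.choose, hB.choose_spec⟩⟩
  Finset.univ.inf' Finset.univ_nonempty fun B : Fin n → {B // B ∈ 𝒝} =>
    Finset.univ.sup' Finset.univ_nonempty fun A : Fin n → {A // A ∈ 𝒜} =>
      ν (prodABFin (fun i => (A i : Matrix (Fin N) (Fin M) ℝ))
          (fun i => (B i : Matrix (Fin M) (Fin N) ℝ)))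

/-- The lower minimax joint spectral radius `μ(𝒜,𝒝) = inf_{n ≥ 1} μ_n(𝒜,𝒝)^{1/n}`. -/
noncomputable def muJSR {N M : ℕ} (𝒜 : Finset (Matrix (Fin N) (Fin M) ℝ))
    (𝒝 : Finset (Matrix (Fin M) (Fin N) ℝ)) (hA : 𝒜.Nonempty) (hB : 𝒝.Nonempty)
    (ν : Matrix (Fin N) (Fin N) ℝ → ℝ) : ℝ :=
  ⨅ n : ℕ, muN 𝒜 𝒝 hA hB ν (n + 1) ^ (1 / ((n : ℝ) + 1))

/-- The upper minimax joint spectral radius `η(𝒜,𝒝) = inf_{n ≥ 1} η_n(𝒜,𝒝)^{1/n}`. -/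
noncomputable def etaJSR {N M : ℕ} (𝒜 : Finset (Matrix (Fin N) (Fin M) ℝ))
    (𝒝 : Finset (Matrix (Fin M) (Fin N) ℝ)) (hA : 𝒜.Nonempty) (hB : 𝒝.Nonempty)
    (ν : Matrix (Fin N) (Fin N) ℝ → ℝ) : ℝ :=
  ⨅ n : ℕ, etaN 𝒜 𝒝 hA hB ν (n + 1) ^ (1 / ((n : ℝ) + 1))

theorem pow_mul_add_le_of_submultiplicative {u : ℕ → ℝ} (h0 : ∀ n, 0 ≤ u n)
    (hu : ∀ m n, u (m + n) ≤ u m * u n) (k n r : ℕ) : u (k * n + r) ≤ u n ^ k * u r := by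
  induction k with
  | zero => simp
  | succ k ih =>
    calc
      u ((k + 1) * n + r) = u (n + (k * n + r)) := by congr 1; ring
      _ ≤ u n * u (k * n + r) := hu _ _
      _ ≤ u n * (u n ^ k * u r) := mul_le_mul_of_nonneg_left ih (h0 n)
      _ = u n ^ (k + 1) * u r := by ring

/-- If one term of a submultiplicative sequence satisfies `u n ≤ a ^ n`, then the whole sequence
is bounded by a constant multiple of `a ^ p`. -/
theorem exists_forall_le_mul_pow_of_submultiplicative {u : ℕ → ℝ} (h0 : ∀ n, 0 ≤ u n)
    (hu : ∀ m n, u (m + n) ≤ u m * u n) {n : ℕ} (hn : 0 < n) {a : ℝ} (ha : 0 < a)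
    (hna : u n ≤ a ^ n) : ∃ C > 0, ∀ p, u p ≤ C * a ^ p := by
  have hterm (r : ℕ) : 0 ≤ u r / a ^ r := div_nonneg (h0 r) (pow_pos ha r).le
  refine ⟨∑ r ∈ Finset.range n, u r / a ^ r + 1,
    add_pos_of_nonneg_of_pos (Finset.sum_nonneg fun r _ => hterm r) one_pos, fun p => ?_⟩
  set k := p / n
  set r := p % n
  have hp : k * n + r = p := Nat.div_add_mod' p n
  have hr : u r / a ^ r ≤ ∑ r ∈ Finset.range n, u r / a ^ r + 1 :=
    (Finset.single_le_sum (f := fun r => u r / a ^ r) (fun r _ => hterm r)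
      (Finset.mem_range.2 (Nat.mod_lt p hn))).trans (le_add_of_nonneg_right zero_le_one)
  calc
    u p = u (k * n + r) := by rw [hp]
    _ ≤ u n ^ k * u r := pow_mul_add_le_of_submultiplicative h0 hu k n r
    _ ≤ (a ^ n) ^ k * u r :=
      mul_le_mul_of_nonneg_right (pow_le_pow_left₀ (h0 n) hna k) (h0 r)
    _ = u r / a ^ r * a ^ (k * n + r) := by
      rw [pow_add, mul_comm k n, pow_mul]
      field_simp
    _ ≤ (∑ r ∈ Finset.range n, u r / a ^ r + 1) * a ^ (k * n + r) :=
      mul_le_mul_of_nonneg_right hr (pow_pos ha _).le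
    _ = _ := by rw [hp]

/-- Fekete's lemma for nonnegative submultiplicative sequences. -/
theorem tendsto_rpow_inv_of_submultiplicative {u : ℕ → ℝ} (h0 : ∀ n, 0 ≤ u n)
    (hu : ∀ m n, u (m + n) ≤ u m * u n) :
    Tendsto (fun n : ℕ => u n ^ (1 / (n : ℝ))) atTop
      (nhds (⨅ n : ℕ, u (n + 1) ^ (1 / ((n : ℝ) + 1)))) := by
  have hbdd : BddBelow (Set.range fun n : ℕ => u (n + 1) ^ (1 / ((n : ℝ) + 1))) :=
    ⟨0, Set.forall_mem_range.2 fun n => Real.rpow_nonneg (h0 _) _⟩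
  refine tendsto_order.2 ⟨fun l hl => ?_, fun L hL => ?_⟩
  · filter_upwards [eventually_ge_atTop 1] with p hp
    obtain ⟨n, rfl⟩ := Nat.exists_eq_add_of_le' hp
    exact_mod_cast hl.trans_le (ciInf_le hbdd n)
  · obtain ⟨n, hn⟩ := exists_lt_of_ciInf_lt hL
    obtain ⟨a, hna, haL⟩ := exists_between hn
    have ha : 0 < a := (Real.rpow_nonneg (h0 _) _).trans_lt hna
    have hpow : u (n + 1) ≤ a ^ (n + 1) := by
      have h := pow_le_pow_left₀ (Real.rpow_nonneg (h0 _) _) hna.le (n + 1)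
      rwa [← Nat.cast_add_one, one_div, Real.rpow_inv_natCast_pow (h0 _) n.succ_ne_zero] at h
    obtain ⟨C, hC, hle⟩ :=
      exists_forall_le_mul_pow_of_submultiplicative h0 hu n.succ_pos ha hpow
    have hlim : Tendsto (fun p : ℕ => C ^ (1 / (p : ℝ)) * a) atTop (nhds a) := by
      have h := (tendsto_const_nhds (x := C)).rpow tendsto_one_div_atTop_nhds_zero_nat
        (Or.inl hC.ne')
      simpa using h.mul_const a
    filter_upwards [hlim.eventually_lt_const haL, eventually_ge_atTop 1] with p hpL hp
    refine lt_of_le_of_lt ?_ hpL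
    calc
      u p ^ (1 / (p : ℝ)) ≤ (C * a ^ p) ^ (1 / (p : ℝ)) :=
        Real.rpow_le_rpow (h0 p) (hle p) (by positivity)
      _ = C ^ (1 / (p : ℝ)) * a := by
        rw [Real.mul_rpow hC.le (pow_pos ha p).le, one_div,
          Real.pow_rpow_inv_natCast ha.le (Nat.one_le_iff_ne_zero.1 hp)]

theorem prodABFin_append {N M m n : ℕ} (A : Fin (m + n) → Matrix (Fin N) (Fin M) ℝ)
    (B₁ : Fin m → Matrix (Fin M) (Fin N) ℝ) (B₂ : Fin n → Matrix (Fin M) (Fin N) ℝ) :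
    prodABFin A (Fin.append B₁ B₂) =
      prodABFin (fun i => A (Fin.natAdd m i)) B₂ * prodABFin (fun i => A (Fin.castAdd n i)) B₁ := by
  simp [prodABFin, List.ofFn_add, Fin.castAdd]

theorem muN_nonneg {N M : ℕ} (𝒜 : Finset (Matrix (Fin N) (Fin M) ℝ))
    (𝒝 : Finset (Matrix (Fin M) (Fin N) ℝ)) (hA : 𝒜.Nonempty) (hB : 𝒝.Nonempty)
    {ν : Matrix (Fin N) (Fin N) ℝ → ℝ} (hν : ∀ X, 0 ≤ ν X) (n : ℕ) :
    0 ≤ muN 𝒜 𝒝 hA hB ν n := by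
  have : Nonempty {A // A ∈ 𝒜} := hA.to_subtype
  rw [muN, Finset.le_sup'_iff]
  exact ⟨Classical.arbitrary _, Finset.mem_univ _, Finset.le_inf' _ _ fun _ _ => hν _⟩

theorem muN_add_le {N M : ℕ} (𝒜 : Finset (Matrix (Fin N) (Fin M) ℝ))
    (𝒝 : Finset (Matrix (Fin M) (Fin N) ℝ)) (hA : 𝒜.Nonempty) (hB : 𝒝.Nonempty)
    {ν : Matrix (Fin N) (Fin N) ℝ → ℝ} (hν : ∀ X, 0 ≤ ν X)
    (hν_mul : ∀ X Y, ν (X * Y) ≤ ν X * ν Y) (m n : ℕ) :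
    muN 𝒜 𝒝 hA hB ν (m + n) ≤ muN 𝒜 𝒝 hA hB ν m * muN 𝒜 𝒝 hA hB ν n := by
  have exists_le (k : ℕ) (A : Fin k → {A // A ∈ 𝒜}) : ∃ B : Fin k → {B // B ∈ 𝒝},
      ν (prodABFin (fun i => (A i : Matrix (Fin N) (Fin M) ℝ))
        (fun i => (B i : Matrix (Fin M) (Fin N) ℝ))) ≤ muN 𝒜 𝒝 hA hB ν k := by
    have : Nonempty {B // B ∈ 𝒝} := hB.to_subtype
    obtain ⟨B, -, h⟩ := Finset.exists_mem_eq_inf' Finset.univ_nonempty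
      fun B : Fin k → {B // B ∈ 𝒝} =>
        ν (prodABFin (fun i => (A i : Matrix (Fin N) (Fin M) ℝ))
          (fun i => (B i : Matrix (Fin M) (Fin N) ℝ)))
    refine ⟨B, ?_⟩
    rw [← h, muN]
    exact Finset.le_sup' (fun A : Fin k → {A // A ∈ 𝒜} =>
      Finset.univ.inf' Finset.univ_nonempty fun B : Fin k → {B // B ∈ 𝒝} =>
        ν (prodABFin (fun i => (A i : Matrix (Fin N) (Fin M) ℝ))
          (fun i => (B i : Matrix (Fin M) (Fin N) ℝ)))) (Finset.mem_univ A)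
  conv_lhs => rw [muN]
  refine Finset.sup'_le _ _ fun A _ => ?_
  obtain ⟨B₁, h₁⟩ := exists_le m fun i => A (Fin.castAdd n i)
  obtain ⟨B₂, h₂⟩ := exists_le n fun i => A (Fin.natAdd m i)
  refine (Finset.inf'_le _ (Finset.mem_univ (Fin.append B₁ B₂))).trans ?_
  have happ : (fun i => (Fin.append B₁ B₂ i).1) =
      Fin.append (fun i => (B₁ i : Matrix (Fin M) (Fin N) ℝ)) fun i => (B₂ i).1 := by
    ext1 i
    refine Fin.addCases (fun i => ?_) (fun i => ?_) i <;> simp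
  rw [happ, prodABFin_append, mul_comm (muN 𝒜 𝒝 hA hB ν m)]
  exact (hν_mul _ _).trans (mul_le_mul h₂ h₁ (hν _) (muN_nonneg 𝒜 𝒝 hA hB hν n))

/-- If `ν` is the operator norm on `N×N` matrices induced by a
vector norm on `ℝ^N` (so in particular `ν` is a norm satisfying
`ν (X * Y) ≤ ν X * ν Y`), then the sequence `n ↦ μ_n(𝒜,𝒝)^{1/n}` converges as
`n → ∞`, and its limit equals `inf_{n ≥ 1} μ_n(𝒜,𝒝)^{1/n}`. -/
theorem muN_pow_inv_tendsto {N M : ℕ} (𝒜 : Finset (Matrix (Fin N) (Fin M) ℝ))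
    (𝒝 : Finset (Matrix (Fin M) (Fin N) ℝ)) (hA : 𝒜.Nonempty) (hB : 𝒝.Nonempty)
    (ν : Matrix (Fin N) (Fin N) ℝ → ℝ)
    (hν_zero : ∀ X : Matrix (Fin N) (Fin N) ℝ, ν X = 0 ↔ X = 0)
    (hν_smul : ∀ (c : ℝ) (X : Matrix (Fin N) (Fin N) ℝ), ν (c • X) = |c| * ν X)
    (hν_add : ∀ X Y : Matrix (Fin N) (Fin N) ℝ, ν (X + Y) ≤ ν X + ν Y)
    (hν_mul : ∀ X Y : Matrix (Fin N) (Fin N) ℝ, ν (X * Y) ≤ ν X * ν Y) :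
    Tendsto (fun n : ℕ => muN 𝒜 𝒝 hA hB ν n ^ (1 / (n : ℝ))) atTop
      (nhds (⨅ n : ℕ, muN 𝒜 𝒝 hA hB ν (n + 1) ^ (1 / ((n : ℝ) + 1)))) := by
  have hν (X : Matrix (Fin N) (Fin N) ℝ) : 0 ≤ ν X := by
    have hadd := hν_add X ((-1 : ℝ) • X)
    have hzero : X + (-1 : ℝ) • X = 0 := by simp
    rw [hzero, (hν_zero 0).2 rfl, hν_smul] at hadd
    norm_num at hadd
    linarith
  exact tendsto_rpow_inv_of_submultiplicative (muN_nonneg 𝒜 𝒝 hA hB hν)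
    (muN_add_le 𝒜 𝒝 hA hB hν hν_mul)
end

section
/- The following are equivalent: (i) there exist a positive integer k and a sequence (B̄_n)_{n≥1} with B̄_n ∈ 𝒝 that is k-periodic (B̄_{n+k} = B̄_n for all n) such that for every sequence (A_n)_{n≥1} with A_n ∈ 𝒜 one has ‖A_n B̄_n ⋯ A_1 B̄_1‖ → 0 as n → ∞ (path-independent periodic stabilizability); (ii) η(𝒜,𝒝) < 1. -/
open Filter

theorem prodABFin_eq_prodAB {N M : ℕ} (A : ℕ → Matrix (Fin N) (Fin M) ℝ)
    (B : ℕ → Matrix (Fin M) (Fin N) ℝ) (n : ℕ) :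
    prodABFin (fun i : Fin n => A i) (fun i : Fin n => B i) = prodAB A B n := by
  induction n with
  | zero => simp [prodABFin, prodAB]
  | succ n ih =>
    rw [prodAB, ← ih]
    rw [prodABFin, List.ofFn_succ_last]
    simp [prodABFin]

theorem prodAB_add {N M : ℕ} (A : ℕ → Matrix (Fin N) (Fin M) ℝ)
    (B : ℕ → Matrix (Fin M) (Fin N) ℝ) (m n : ℕ) :
    prodAB A B (m + n) =
      prodAB (fun i => A (i + n)) (fun i => B (i + n)) m * prodAB A B n := by
  induction m with
  | zero => simp [prodAB]
  | succ m ih => rw [Nat.add_right_comm, prodAB, ih, prodAB, ← Matrix.mul_assoc]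

section SubmultiplicativeNorm

variable {N M : ℕ} {𝒜 : Finset (Matrix (Fin N) (Fin M) ℝ)}
  {𝒝 : Finset (Matrix (Fin M) (Fin N) ℝ)} {ν : Matrix (Fin N) (Fin N) ℝ → ℝ}

/-- Products of the first `n ≤ L` pairs of factors are uniformly bounded. -/
theorem exists_bound_prodAB_of_le (hν_nonneg : ∀ X, 0 ≤ ν X)
    (hν_mul : ∀ X Y, ν (X * Y) ≤ ν X * ν Y) (L : ℕ) :
    ∃ C, 0 ≤ C ∧ ∀ A : ℕ → Matrix (Fin N) (Fin M) ℝ, (∀ n, A n ∈ 𝒜) →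
      ∀ B : ℕ → Matrix (Fin M) (Fin N) ℝ, (∀ n, B n ∈ 𝒝) →
        ∀ n ≤ L, ν (prodAB A B n) ≤ C := by
  obtain ⟨R, hR⟩ := ((𝒜 ×ˢ 𝒝).image fun p => ν (p.1 * p.2)).bddAbove
  have hR' : ∀ X ∈ 𝒜, ∀ Y ∈ 𝒝, ν (X * Y) ≤ max R 1 := fun X hX Y hY =>
    (hR (Finset.mem_coe.2 (Finset.mem_image.2
      ⟨(X, Y), Finset.mem_product.2 ⟨hX, hY⟩, rfl⟩))).trans (le_max_left _ _)
  refine ⟨max R 1 ^ L * ν 1, mul_nonneg (by positivity) (hν_nonneg _), fun A hA B hB n hn => ?_⟩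
  have key : ∀ n, ν (prodAB A B n) ≤ max R 1 ^ n * ν 1 := by
    intro n
    induction n with
    | zero => simp [prodAB]
    | succ n ih =>
      calc ν (prodAB A B (n + 1)) ≤ ν (A n * B n) * ν (prodAB A B n) := hν_mul _ _
        _ ≤ max R 1 * (max R 1 ^ n * ν 1) :=
          mul_le_mul (hR' _ (hA n) _ (hB n)) ih (hν_nonneg _) (by positivity)
        _ = max R 1 ^ (n + 1) * ν 1 := by ring
  exact (key n).trans (mul_le_mul_of_nonneg_right
    (pow_le_pow_right₀ (le_max_right _ _) hn) (hν_nonneg _))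

/-- If along every path the product contracts by a factor `q < 1` at some multiple of the period,
at most `K` periods away, then all products tend to `0`, uniformly in the path. -/
theorem exists_forall_prodAB_lt_of_contracting (hν_nonneg : ∀ X, 0 ≤ ν X)
    (hν_mul : ∀ X Y, ν (X * Y) ≤ ν X * ν Y) {B : ℕ → Matrix (Fin M) (Fin N) ℝ}
    (hB : ∀ n, B n ∈ 𝒝) {k : ℕ} (hk : 1 ≤ k) (hper : ∀ n, B (n + k) = B n)
    {K : ℕ} {q : ℝ} (hq0 : 0 ≤ q) (hq1 : q < 1)
    (hcontr : ∀ A : ℕ → Matrix (Fin N) (Fin M) ℝ, (∀ n, A n ∈ 𝒜) →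
      ∃ m, 1 ≤ m ∧ m ≤ K ∧ ν (prodAB A B (m * k)) ≤ q) {ε : ℝ} (hε : 0 < ε) :
    ∃ n₀, ∀ n ≥ n₀, ∀ A : ℕ → Matrix (Fin N) (Fin M) ℝ, (∀ n, A n ∈ 𝒜) →
      ν (prodAB A B n) < ε := by
  obtain ⟨C, hC0, hC⟩ :=
    exists_bound_prodAB_of_le (𝒜 := 𝒜) (𝒝 := 𝒝) hν_nonneg hν_mul (K * k)
  have hshift : ∀ m, (fun i => B (i + m * k)) = B := by
    intro m
    funext i
    simpa using (Function.Periodic.nat_mul (f := B) hper m) i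
  have hstep : ∀ n, K * k ≤ n → ∀ A : ℕ → Matrix (Fin N) (Fin M) ℝ, (∀ n, A n ∈ 𝒜) →
      ∃ n' A', n' < n ∧ n ≤ n' + K * k ∧ (∀ i, A' i ∈ 𝒜) ∧
        ν (prodAB A B n) ≤ ν (prodAB A' B n') * q := by
    intro n hn A hA
    obtain ⟨m, hm1, hmK, hm⟩ := hcontr A hA
    have h1 : m * k ≤ K * k := Nat.mul_le_mul_right k hmK
    have h2 : 1 ≤ m * k := Nat.mul_pos hm1 hk
    refine ⟨n - m * k, fun i => A (i + m * k), by omega, by omega, fun i => hA _, ?_⟩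
    conv_lhs => rw [← Nat.sub_add_cancel (h1.trans hn), prodAB_add, hshift]
    exact (hν_mul _ _).trans (mul_le_mul_of_nonneg_left hm (hν_nonneg _))
  have hbdd : ∀ n, ∀ A : ℕ → Matrix (Fin N) (Fin M) ℝ, (∀ n, A n ∈ 𝒜) →
      ν (prodAB A B n) ≤ C := by
    intro n
    induction n using Nat.strong_induction_on with
    | _ n ih =>
      intro A hA
      rcases le_total n (K * k) with h | h
      · exact hC A hA B hB n h
      · obtain ⟨n', A', hn', -, hA', hle⟩ := hstep n h A hA
        exact hle.trans ((mul_le_of_le_one_right (hν_nonneg _) hq1.le).trans (ih n' hn' A' hA'))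
  have hdecay : ∀ j n, j * (K * k) ≤ n → ∀ A : ℕ → Matrix (Fin N) (Fin M) ℝ,
      (∀ n, A n ∈ 𝒜) → ν (prodAB A B n) ≤ C * q ^ j := by
    intro j
    induction j with
    | zero => intro n _ A hA; simpa using hbdd n A hA
    | succ j ih =>
      intro n hn A hA
      rw [Nat.succ_mul] at hn
      obtain ⟨n', A', -, hn', hA', hle⟩ := hstep n (by omega) A hA
      calc ν (prodAB A B n) ≤ ν (prodAB A' B n') * q := hle
        _ ≤ C * q ^ j * q := mul_le_mul_of_nonneg_right (ih n' (by omega) A' hA') hq0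
        _ = C * q ^ (j + 1) := by ring
  have hlim : Tendsto (fun j => C * q ^ j) atTop (nhds 0) := by
    simpa using (tendsto_pow_atTop_nhds_zero_of_lt_one hq0 hq1).const_mul C
  obtain ⟨j, hj⟩ := (hlim.eventually_lt_const hε).exists
  exact ⟨j * (K * k), fun n hn A hA => (hdecay j n hn A hA).trans_lt hj⟩

/-- By compactness of the space of paths, products that become smaller than `q` along every path
do so within a uniformly bounded number of periods. -/
theorem exists_uniform_period_bound {B : ℕ → Matrix (Fin M) (Fin N) ℝ} {k : ℕ} {q : ℝ}
    (h : ∀ A : ℕ → Matrix (Fin N) (Fin M) ℝ, (∀ n, A n ∈ 𝒜) →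
      ∃ m, 1 ≤ m ∧ ν (prodAB A B (m * k)) < q) :
    ∃ K, ∀ A : ℕ → Matrix (Fin N) (Fin M) ℝ, (∀ n, A n ∈ 𝒜) →
      ∃ m, 1 ≤ m ∧ m ≤ K ∧ ν (prodAB A B (m * k)) < q := by
  let U : ℕ → Set (ℕ → {A // A ∈ 𝒜}) := fun m =>
    {a | 1 ≤ m ∧ ν (prodAB (fun i => (a i : Matrix (Fin N) (Fin M) ℝ)) B (m * k)) < q}
  have hU : ∀ m, IsOpen (U m) := by
    intro m
    have hres : Continuous fun (a : ℕ → {A // A ∈ 𝒜}) (i : Fin (m * k)) => a i := by fun_prop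
    have hpre := (isOpen_discrete {c : Fin (m * k) → {A // A ∈ 𝒜} |
      1 ≤ m ∧ ν (prodABFin (fun i => (c i : Matrix (Fin N) (Fin M) ℝ)) (fun i => B i)) < q}).preimage
        hres
    convert hpre using 1
    ext a
    simp only [U, Set.mem_preimage, Set.mem_ofPred_eq,
      prodABFin_eq_prodAB (fun i => (a i : Matrix (Fin N) (Fin M) ℝ)) B]
  obtain ⟨t, ht⟩ := isCompact_univ.elim_finite_subcover U hU (fun a _ => by
    obtain ⟨m, hm⟩ := h (fun i => a i) fun i => (a i).2
    exact Set.mem_iUnion.2 ⟨m, hm⟩)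
  refine ⟨t.sup id, fun A hA => ?_⟩
  obtain ⟨m, hmt, hm1, hm⟩ := Set.mem_iUnion₂.1 (ht (Set.mem_univ fun i => ⟨A i, hA i⟩))
  exact ⟨m, hm1, Finset.le_sup (f := id) hmt, hm⟩

theorem etaN_lt_iff (hA : 𝒜.Nonempty) (hB : 𝒝.Nonempty) (n : ℕ) (r : ℝ) :
    etaN 𝒜 𝒝 hA hB ν n < r ↔
      ∃ B : ℕ → Matrix (Fin M) (Fin N) ℝ, (∀ i, B i ∈ 𝒝) ∧
        ∀ A : ℕ → Matrix (Fin N) (Fin M) ℝ, (∀ i, A i ∈ 𝒜) → ν (prodAB A B n) < r := by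
  simp only [etaN, Finset.inf'_lt_iff, Finset.sup'_lt_iff, Finset.mem_univ, true_and, true_imp_iff]
  constructor
  · rintro ⟨b, hb⟩
    obtain ⟨B₀, hB₀⟩ := id hB
    refine ⟨fun i => if h : i < n then b ⟨i, h⟩ else B₀, fun i => ?_, fun A hA => ?_⟩
    · dsimp only
      split_ifs
      exacts [(b _).2, hB₀]
    · rw [← prodABFin_eq_prodAB]
      simpa using hb fun i => ⟨A i, hA i⟩
  · rintro ⟨B, hBmem, hB'⟩
    obtain ⟨A₀, hA₀⟩ := id hA
    refine ⟨fun i => ⟨B i, hBmem i⟩, fun a => ?_⟩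
    have := hB' (fun i => if h : i < n then a ⟨i, h⟩ else A₀) fun i => by
      split_ifs
      exacts [(a _).2, hA₀]
    rw [← prodABFin_eq_prodAB] at this
    simpa using this

theorem etaN_nonneg (hν_nonneg : ∀ X, 0 ≤ ν X) (hA : 𝒜.Nonempty) (hB : 𝒝.Nonempty) (n : ℕ) :
    0 ≤ etaN 𝒜 𝒝 hA hB ν n := by
  by_contra! h
  obtain ⟨B, -, hB'⟩ := (etaN_lt_iff hA hB n 0).1 h
  exact (hB' (fun _ => hA.choose) fun _ => hA.choose_spec).not_ge (hν_nonneg _)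

theorem etaJSR_lt_one_iff (hν_nonneg : ∀ X, 0 ≤ ν X) (hA : 𝒜.Nonempty) (hB : 𝒝.Nonempty) :
    etaJSR 𝒜 𝒝 hA hB ν < 1 ↔ ∃ n, etaN 𝒜 𝒝 hA hB ν (n + 1) < 1 := by
  have hbdd : BddBelow (Set.range fun n : ℕ =>
      etaN 𝒜 𝒝 hA hB ν (n + 1) ^ (1 / ((n : ℝ) + 1))) :=
    ⟨0, by
      rintro _ ⟨n, rfl⟩
      exact Real.rpow_nonneg (etaN_nonneg hν_nonneg hA hB _) _⟩
  rw [etaJSR, ciInf_lt_iff hbdd]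
  refine exists_congr fun n => ?_
  have hn : (0 : ℝ) < 1 / ((n : ℝ) + 1) := by positivity
  refine ⟨fun h => ?_, fun h => Real.rpow_lt_one (etaN_nonneg hν_nonneg hA hB _) h hn⟩
  by_contra! h1
  exact h.not_ge (Real.one_le_rpow h1 hn.le)

end SubmultiplicativeNorm

/-- **Theorem: path-independent periodic stabilizability.** Let
`ν` be the operator norm on `N×N` matrices induced by a vector norm on `ℝ^N`
(a norm with `ν (X*Y) ≤ ν X * ν Y`).  The following are equivalent: there exist
`k ≥ 1` and a `k`-periodic sequence `(B̄_n) ⊆ 𝒝` such that for every sequence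
`(A_n) ⊆ 𝒜` one has `ν (A_n B̄_n ⋯ A_1 B̄_1) → 0` as `n → ∞`  ⟺  `η(𝒜,𝒝) < 1`. -/
theorem periodicStabilizable_iff_etaJSR_lt_one {N M : ℕ}
    (𝒜 : Finset (Matrix (Fin N) (Fin M) ℝ))
    (𝒝 : Finset (Matrix (Fin M) (Fin N) ℝ)) (hA : 𝒜.Nonempty) (hB : 𝒝.Nonempty)
    (ν : Matrix (Fin N) (Fin N) ℝ → ℝ)
    (hν_zero : ∀ X : Matrix (Fin N) (Fin N) ℝ, ν X = 0 ↔ X = 0)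
    (hν_smul : ∀ (c : ℝ) (X : Matrix (Fin N) (Fin N) ℝ), ν (c • X) = |c| * ν X)
    (hν_add : ∀ X Y : Matrix (Fin N) (Fin N) ℝ, ν (X + Y) ≤ ν X + ν Y)
    (hν_mul : ∀ X Y : Matrix (Fin N) (Fin N) ℝ, ν (X * Y) ≤ ν X * ν Y) :
    (∃ k : ℕ, 1 ≤ k ∧ ∃ Bbar : ℕ → Matrix (Fin M) (Fin N) ℝ,
        (∀ n, Bbar n ∈ 𝒝) ∧ (∀ n, Bbar (n + k) = Bbar n) ∧
          ∀ A : ℕ → Matrix (Fin N) (Fin M) ℝ, (∀ n, A n ∈ 𝒜) →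
            Filter.Tendsto (fun n => ν (prodAB A Bbar n)) atTop (nhds 0)) ↔
      etaJSR 𝒜 𝒝 hA hB ν < 1 := by
  have hν_nonneg : ∀ X, 0 ≤ ν X := by
    intro X
    have h := hν_add X ((-1 : ℝ) • X)
    rw [hν_smul, neg_one_smul, add_neg_cancel, (hν_zero 0).2 rfl] at h
    norm_num at h
    linarith
  rw [etaJSR_lt_one_iff hν_nonneg hA hB]
  constructor
  · rintro ⟨k, hk, B, hBmem, hper, hlim⟩
    obtain ⟨K, hK⟩ := exists_uniform_period_bound (𝒜 := 𝒜) (ν := ν) (B := B) (k := k)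
      (q := 1 / 2) (fun A hAmem => by
        have hmul : Tendsto (fun m : ℕ => m * k) atTop atTop :=
          tendsto_id.atTop_mul_const' hk
        obtain ⟨m, hm, hm1⟩ := ((((hlim A hAmem).comp hmul).eventually_lt_const
          (by norm_num : (0 : ℝ) < 1 / 2)).and (eventually_ge_atTop 1)).exists
        exact ⟨m, hm1, hm⟩)
    obtain ⟨n₀, hn₀⟩ := exists_forall_prodAB_lt_of_contracting (q := 1 / 2) hν_nonneg hν_mul hBmem
      hk hper (by norm_num) (by norm_num)
      (fun A hAmem => (hK A hAmem).imp fun m hm => ⟨hm.1, hm.2.1, hm.2.2.le⟩) one_pos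
    exact ⟨n₀, (etaN_lt_iff hA hB _ _).2 ⟨B, hBmem, hn₀ (n₀ + 1) n₀.le_succ⟩⟩
  · rintro ⟨n, hn⟩
    obtain ⟨q, hq, hq1⟩ := exists_between hn
    have hq0 : 0 ≤ q := (etaN_nonneg hν_nonneg hA hB _).trans hq.le
    obtain ⟨B, hBmem, hB'⟩ := (etaN_lt_iff hA hB _ _).1 hq
    have hmem : ∀ i, B (i % (n + 1)) ∈ 𝒝 := fun i => hBmem _
    have hper : ∀ i, B ((i + (n + 1)) % (n + 1)) = B (i % (n + 1)) := fun i => by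
      rw [Nat.add_mod_right]
    refine ⟨n + 1, n.succ_pos, fun i => B (i % (n + 1)), hmem, hper, fun A hAmem => ?_⟩
    refine tendsto_order.2 ⟨fun a ha => Eventually.of_forall fun i => ha.trans_le (hν_nonneg _),
      fun ε hε => ?_⟩
    obtain ⟨n₀, hn₀⟩ := exists_forall_prodAB_lt_of_contracting (𝒜 := 𝒜) (K := 1) hν_nonneg hν_mul
      hmem n.succ_pos hper hq0 hq1 (fun A' hA' => ⟨1, le_rfl, le_rfl, by
        have h := hB' A' hA'
        rw [← prodABFin_eq_prodAB] at h
        rw [one_mul, ← prodABFin_eq_prodAB]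
        simpa only [Nat.mod_eq_of_lt (Fin.is_lt _)] using h.le⟩) hε
    exact eventually_atTop.2 ⟨n₀, fun i hi => hn₀ i hi A hAmem⟩
end

section
/- The following are equivalent: (i) for every sequence (A_n)_{n≥1} with A_n ∈ 𝒜 and every x(0) ∈ ℝ^N, the vectors A_n ⋯ A_1 x(0) converge to 0 as n → ∞ (asymptotic stability); (ii) ρ(𝒜) < 1. -/
open Filter

/-- The product `A_n ⋯ A_1` of the first `n` factors of a sequence of square
matrices (the factor with index `i`, `1 ≤ i ≤ n`, being `A (i-1)`). -/
def prodA {N : ℕ} (A : ℕ → Matrix (Fin N) (Fin N) ℝ) : ℕ → Matrix (Fin N) (Fin N) ℝ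
  | 0 => 1
  | n + 1 => A n * prodA A n

/-- The product `A_n ⋯ A_1` for a collection of square matrices indexed by `Fin n`. -/
def prodAFin {N n : ℕ} (A : Fin n → Matrix (Fin N) (Fin N) ℝ) : Matrix (Fin N) (Fin N) ℝ :=
  (List.ofFn A).reverse.prod

/-- The joint spectral radius `ρ(𝒜) = inf_{n ≥ 1} (max_{A_i ∈ 𝒜} ν (A_n ⋯ A_1))^{1/n}`,
computed with respect to a norm `ν` on `N×N` matrices. -/
noncomputable def jointSR {N : ℕ} (𝒜 : Finset (Matrix (Fin N) (Fin N) ℝ)) (hA : 𝒜.Nonempty)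
    (ν : Matrix (Fin N) (Fin N) ℝ → ℝ) : ℝ :=
  haveI : Nonempty {A // A ∈ 𝒜} := ⟨⟨hA.choose, hA.choose_spec⟩⟩
  ⨅ n : ℕ,
    (Finset.univ.sup' Finset.univ_nonempty fun A : Fin (n + 1) → {A // A ∈ 𝒜} =>
        ν (prodAFin fun i => (A i : Matrix (Fin N) (Fin N) ℝ))) ^ (1 / ((n : ℝ) + 1))

/-- The lower spectral radius `ρ̌(𝒜) = inf_{n ≥ 1} (min_{A_i ∈ 𝒜} ν (A_n ⋯ A_1))^{1/n}`,
computed with respect to a norm `ν` on `N×N` matrices. -/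
noncomputable def lowerSR {N : ℕ} (𝒜 : Finset (Matrix (Fin N) (Fin N) ℝ)) (hA : 𝒜.Nonempty)
    (ν : Matrix (Fin N) (Fin N) ℝ → ℝ) : ℝ :=
  haveI : Nonempty {A // A ∈ 𝒜} := ⟨⟨hA.choose, hA.choose_spec⟩⟩
  ⨅ n : ℕ,
    (Finset.univ.inf' Finset.univ_nonempty fun A : Fin (n + 1) → {A // A ∈ 𝒜} =>
        ν (prodAFin fun i => (A i : Matrix (Fin N) (Fin N) ℝ))) ^ (1 / ((n : ℝ) + 1))

theorem prodA_add {N : ℕ} (A : ℕ → Matrix (Fin N) (Fin N) ℝ) (n m : ℕ) :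
    prodA A (n + m) = prodA (fun i => A (n + i)) m * prodA A n := by
  induction m with
  | zero => simp [prodA]
  | succ m ih => rw [← add_assoc, prodA, ih, prodA, mul_assoc]

theorem prodAFin_eq_prodA {N : ℕ} (A : ℕ → Matrix (Fin N) (Fin N) ℝ) (n : ℕ) :
    prodAFin (fun i : Fin n => A i) = prodA A n := by
  induction n with
  | zero => simp [prodAFin, prodA]
  | succ n ih =>
    rw [prodA, ← ih, prodAFin, prodAFin, List.ofFn_succ']
    simp

theorem continuous_prodA {N : ℕ} (n : ℕ) :
    Continuous fun A : ℕ → Matrix (Fin N) (Fin N) ℝ => prodA A n := by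
  induction n with
  | zero => exact continuous_const
  | succ n ih => exact (continuous_apply n).matrix_mul ih

section AlgebraNorm

variable {N : ℕ} (ν : AlgebraNorm ℝ (Matrix (Fin N) (Fin N) ℝ))

/-- An algebra norm on matrices is dominated by a weighted entrywise `ℓ¹` norm. -/
theorem AlgebraNorm.le_sum_abs_entries (X : Matrix (Fin N) (Fin N) ℝ) :
    ν X ≤ ∑ i, ∑ j, |X i j| * ν (Matrix.single i j 1) := by
  conv_lhs => rw [Matrix.matrix_eq_sum_single X]
  refine (Finset.le_sum_of_subadditive ν (map_zero ν).le (map_add_le_add ν) _ _).trans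
    (Finset.sum_le_sum fun i _ => ?_)
  refine (Finset.le_sum_of_subadditive ν (map_zero ν).le (map_add_le_add ν) _ _).trans
    (Finset.sum_le_sum fun j _ => ?_)
  rw [← Real.norm_eq_abs, ← map_smul_eq_mul ν, Matrix.smul_single, smul_eq_mul, mul_one]

/-- Each entry of a matrix is controlled by an algebra norm. -/
theorem AlgebraNorm.abs_entry_le (i j : Fin N) :
    ∃ C : ℝ, ∀ X : Matrix (Fin N) (Fin N) ℝ, |X i j| ≤ C * ν X := by
  have hpos : 0 < ν (Matrix.single i j 1) := by
    refine lt_of_le_of_ne (apply_nonneg ν _) fun h => ?_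
    have h0 := congrFun (congrFun (eq_zero_of_map_eq_zero ν h.symm) i) j
    simp at h0
  refine ⟨ν (Matrix.single i i 1) * ν (Matrix.single j j 1) / ν (Matrix.single i j 1),
    fun X => ?_⟩
  rw [div_mul_eq_mul_div, le_div_iff₀ hpos, ← Real.norm_eq_abs, ← map_smul_eq_mul ν]
  have hX : X i j • Matrix.single i j (1 : ℝ) =
      Matrix.single i i 1 * X * Matrix.single j j 1 := by
    rw [Matrix.single_mul_mul_single]
    simp [Matrix.smul_single]
  calc ν (X i j • Matrix.single i j (1 : ℝ))
      ≤ ν (Matrix.single i i 1) * ν X * ν (Matrix.single j j 1) := by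
        rw [hX]
        exact (map_mul_le_mul ν _ _).trans
          (mul_le_mul_of_nonneg_right (map_mul_le_mul ν _ _) (apply_nonneg ν _))
    _ = _ := by ring

/-- If every sequence has a prefix of length between `1` and `M` whose product has norm at
most `q ≤ 1`, then the products decay geometrically, uniformly over all sequences. -/
theorem AlgebraNorm.exists_prodA_le_geometric {𝒜 : Finset (Matrix (Fin N) (Fin N) ℝ)}
    {M : ℕ} {q : ℝ} (hq1 : q ≤ 1)
    (h : ∀ A : ℕ → Matrix (Fin N) (Fin N) ℝ, (∀ n, A n ∈ 𝒜) →
      ∃ n, 1 ≤ n ∧ n ≤ M ∧ ν (prodA A n) ≤ q) :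
    ∃ C : ℝ, ∀ (m : ℕ) (A : ℕ → Matrix (Fin N) (Fin N) ℝ), (∀ n, A n ∈ 𝒜) →
      ∀ k : ℕ, k * M ≤ m → ν (prodA A m) ≤ C * q ^ k := by
  set K : ℝ := 1 + ∑ X ∈ 𝒜, ν X with hK
  have hK1 : 1 ≤ K := by
    have : 0 ≤ ∑ X ∈ 𝒜, ν X := Finset.sum_nonneg fun X _ => apply_nonneg ν X
    linarith
  have hKX : ∀ X ∈ 𝒜, ν X ≤ K := fun X hX => by
    have := Finset.single_le_sum (f := fun X => ν X) (fun X _ => apply_nonneg ν X) hX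
    linarith
  have hpow : ∀ (A : ℕ → Matrix (Fin N) (Fin N) ℝ), (∀ n, A n ∈ 𝒜) →
      ∀ m, ν (prodA A m) ≤ K ^ m * ν 1 := by
    intro A hA m
    induction m with
    | zero => simp [prodA]
    | succ m ih =>
      calc ν (prodA A (m + 1)) ≤ ν (A m) * ν (prodA A m) := map_mul_le_mul ν _ _
        _ ≤ K * (K ^ m * ν 1) :=
          mul_le_mul (hKX _ (hA m)) ih (apply_nonneg ν _) (by linarith)
        _ = K ^ (m + 1) * ν 1 := by ring
  refine ⟨K ^ M * ν 1, fun m => ?_⟩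
  induction m using Nat.strong_induction_on with
  | _ m ih =>
    intro A hA k hk
    by_cases hm : m < M
    · obtain rfl : k = 0 := by
        by_contra hk0
        exact absurd (Nat.le_mul_of_pos_left M (Nat.pos_of_ne_zero hk0)) (by omega)
      rw [pow_zero, mul_one]
      exact (hpow A hA m).trans (mul_le_mul_of_nonneg_right
        (pow_le_pow_right₀ hK1 hm.le) (apply_nonneg ν _))
    · obtain ⟨n, hn1, hnM, hn⟩ := h A hA
      have hq0 : 0 ≤ q := (apply_nonneg ν _).trans hn
      have hstep : ∀ l, l * M ≤ m - n →
          ν (prodA A m) ≤ K ^ M * ν 1 * q ^ l * q := fun l hl => by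
        have hsub := ih (m - n) (by omega) (fun i => A (n + i)) (fun i => hA _) l hl
        have hsplit := prodA_add A n (m - n)
        rw [Nat.add_sub_cancel' (by omega)] at hsplit
        rw [hsplit]
        exact (map_mul_le_mul ν _ _).trans
          (mul_le_mul hsub hn (apply_nonneg ν _) ((apply_nonneg ν _).trans hsub))
      cases k with
      | zero =>
        have hC : 0 ≤ K ^ M * ν 1 := mul_nonneg (by positivity) (apply_nonneg ν _)
        have := hstep 0 (by omega)
        rw [pow_zero, mul_one] at this ⊢
        exact this.trans (mul_le_of_le_one_right hC hq1)
      | succ k =>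
        rw [add_mul, one_mul] at hk
        rw [pow_succ, ← mul_assoc]
        exact hstep k (by omega)

theorem jointSR_lt_one_iff (𝒜 : Finset (Matrix (Fin N) (Fin N) ℝ)) (hA : 𝒜.Nonempty) :
    jointSR 𝒜 hA ν < 1 ↔ ∃ n : ℕ, ∃ q < 1, ∀ A : ℕ → Matrix (Fin N) (Fin N) ℝ,
      (∀ n, A n ∈ 𝒜) → ν (prodA A (n + 1)) ≤ q := by
  have : Nonempty {A // A ∈ 𝒜} := ⟨⟨hA.choose, hA.choose_spec⟩⟩
  have hsup0 : ∀ n : ℕ, 0 ≤ Finset.univ.sup' Finset.univ_nonempty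
      fun A : Fin (n + 1) → {A // A ∈ 𝒜} =>
        ν (prodAFin fun i => (A i : Matrix (Fin N) (Fin N) ℝ)) := fun n =>
    (apply_nonneg ν _).trans (Finset.le_sup' (fun A : Fin (n + 1) → {A // A ∈ 𝒜} =>
        ν (prodAFin fun i => (A i : Matrix (Fin N) (Fin N) ℝ)))
      (Finset.mem_univ fun _ => Classical.arbitrary _))
  have hinv : ∀ n : ℕ, 0 < 1 / ((n : ℝ) + 1) := fun n => by positivity
  constructor
  · intro h
    obtain ⟨n, hn⟩ := exists_lt_of_ciInf_lt h
    refine ⟨n, _, not_le.1 fun h1 => absurd hn (not_lt.2 (Real.one_le_rpow h1 (hinv n).le)),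
      fun A hA' => ?_⟩
    rw [← prodAFin_eq_prodA]
    exact Finset.le_sup' (fun A : Fin (n + 1) → {A // A ∈ 𝒜} =>
        ν (prodAFin fun i => (A i : Matrix (Fin N) (Fin N) ℝ)))
      (Finset.mem_univ fun i : Fin (n + 1) => ⟨A i, hA' i⟩)
  · rintro ⟨n, q, hq, h⟩
    refine (ciInf_le ⟨0, ?_⟩ n).trans_lt (Real.rpow_lt_one (hsup0 n) ?_ (hinv n))
    · rintro _ ⟨m, rfl⟩
      exact Real.rpow_nonneg (hsup0 m) _
    · refine (Finset.sup'_lt_iff _).2 fun A _ => ?_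
      refine lt_of_le_of_lt ?_ hq
      have hext := prodAFin_eq_prodA
        (fun i => (A (Fin.ofNat (n + 1) i) : Matrix (Fin N) (Fin N) ℝ)) (n + 1)
      simp only [Fin.ofNat_eq_cast, Fin.cast_val_eq_self] at hext
      rw [hext]
      exact h _ fun i => (A _).2

/-- By compactness of the space of sequences in `𝒜`, asymptotic stability yields contracting
prefixes of uniformly bounded length. -/
theorem AlgebraNorm.exists_bounded_contraction_of_stable {𝒜 : Finset (Matrix (Fin N) (Fin N) ℝ)}
    (h : ∀ A : ℕ → Matrix (Fin N) (Fin N) ℝ, (∀ n, A n ∈ 𝒜) →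
      ∀ x₀ : Fin N → ℝ, Tendsto (fun n => (prodA A n).mulVec x₀) atTop (nhds 0))
    {ε : ℝ} (hε : 0 < ε) :
    ∃ M : ℕ, ∀ A : ℕ → Matrix (Fin N) (Fin N) ℝ, (∀ n, A n ∈ 𝒜) →
      ∃ n, 1 ≤ n ∧ n ≤ M ∧ ν (prodA A n) ≤ ε := by
  let μ : Matrix (Fin N) (Fin N) ℝ → ℝ := fun X =>
    ∑ i, ∑ j, |X i j| * ν (Matrix.single i j 1)
  have hμ : Continuous μ := by fun_prop
  have hcompact : IsCompact (Set.univ.pi fun _ : ℕ => (𝒜 : Set (Matrix (Fin N) (Fin N) ℝ))) :=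
    isCompact_univ_pi fun _ => 𝒜.finite_toSet.isCompact
  obtain ⟨t, ht⟩ := hcompact.elim_finite_subcover
    (fun n : ℕ => {A : ℕ → Matrix (Fin N) (Fin N) ℝ | μ (prodA A (n + 1)) < ε})
    (fun n => isOpen_lt (hμ.comp (continuous_prodA (n + 1))) continuous_const) <| by
      intro A hA
      have hlim : Tendsto (fun n => prodA A n) atTop (nhds 0) := by
        refine tendsto_pi_nhds.2 fun i => tendsto_pi_nhds.2 fun j => ?_
        have := tendsto_pi_nhds.1 (h A (fun n => hA n trivial) (Pi.single j 1)) i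
        simpa using this
      have hlim' : Tendsto (fun n => μ (prodA A n)) atTop (nhds 0) := by
        simpa [μ, Function.comp_def] using (hμ.tendsto 0).comp hlim
      have hev := ((tendsto_add_atTop_iff_nat 1).2 hlim').eventually (gt_mem_nhds hε)
      exact Set.mem_iUnion.2 hev.exists
  refine ⟨t.sup id + 1, fun A hA => ?_⟩
  obtain ⟨n, hn, hlt⟩ := Set.mem_iUnion₂.1 (ht fun n _ => hA n)
  exact ⟨n + 1, by omega, Nat.succ_le_succ (Finset.le_sup (f := id) hn),
    (ν.le_sum_abs_entries _).trans (le_of_lt hlt)⟩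

theorem AlgebraNorm.stable_iff_jointSR_lt_one (𝒜 : Finset (Matrix (Fin N) (Fin N) ℝ))
    (hA : 𝒜.Nonempty) :
    (∀ A : ℕ → Matrix (Fin N) (Fin N) ℝ, (∀ n, A n ∈ 𝒜) →
        ∀ x₀ : Fin N → ℝ, Tendsto (fun n => (prodA A n).mulVec x₀) atTop (nhds 0)) ↔
      jointSR 𝒜 hA ν < 1 := by
  rw [jointSR_lt_one_iff]
  constructor
  · intro h
    obtain ⟨M, hM⟩ := ν.exists_bounded_contraction_of_stable h (ε := 1 / 2) (by norm_num)
    obtain ⟨C, hC⟩ := ν.exists_prodA_le_geometric (by norm_num) hM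
    have hlim : Tendsto (fun k : ℕ => C * (1 / 2 : ℝ) ^ k) atTop (nhds 0) := by
      simpa using (tendsto_pow_atTop_nhds_zero_of_lt_one (r := (1 / 2 : ℝ))
        (by norm_num) (by norm_num)).const_mul C
    obtain ⟨k, hk⟩ := (hlim.eventually (gt_mem_nhds one_pos)).exists
    exact ⟨k * M, _, hk, fun A hA' => hC _ A hA' k (Nat.le_succ _)⟩
  · rintro ⟨n, q, hq, h⟩ A hA' x₀
    have hq0 : 0 ≤ q := (apply_nonneg ν _).trans (h A hA')
    obtain ⟨C, hC⟩ := ν.exists_prodA_le_geometric hq.le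
      fun A hA' => ⟨n + 1, by omega, le_rfl, h A hA'⟩
    have hgeom : Tendsto (fun m : ℕ => C * q ^ (m / (n + 1))) atTop (nhds 0) := by
      simpa using ((tendsto_pow_atTop_nhds_zero_of_lt_one hq0 hq).comp
        (Nat.tendsto_div_const_atTop (Nat.succ_ne_zero n))).const_mul C
    have hν : Tendsto (fun m => ν (prodA A m)) atTop (nhds 0) :=
      squeeze_zero (fun m => apply_nonneg ν _)
        (fun m => hC m A hA' _ (Nat.div_mul_le_self m (n + 1))) hgeom
    have hlim : Tendsto (fun m => prodA A m) atTop (nhds 0) := by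
      refine tendsto_pi_nhds.2 fun i => tendsto_pi_nhds.2 fun j => ?_
      obtain ⟨D, hD⟩ := ν.abs_entry_le i j
      refine squeeze_zero_norm (fun m => hD (prodA A m)) ?_
      simpa using hν.const_mul D
    have hcont : Continuous fun X : Matrix (Fin N) (Fin N) ℝ => X.mulVec x₀ :=
      continuous_id.matrix_mulVec continuous_const
    simpa [Function.comp_def] using (hcont.tendsto 0).comp hlim

end AlgebraNorm

/-- **asymptotic stability.** Let `ν` be the operator norm on
`N×N` matrices induced by a vector norm on `ℝ^N` (a norm with
`ν (X*Y) ≤ ν X * ν Y`).  The following are equivalent: for every sequence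
`(A_n) ⊆ 𝒜` and every `x(0) ∈ ℝ^N` the vectors `A_n ⋯ A_1 x(0)` converge to
`0`  ⟺  `ρ(𝒜) < 1`. -/
theorem asymptoticallyStable_iff_jointSR_lt_one {N : ℕ}
    (𝒜 : Finset (Matrix (Fin N) (Fin N) ℝ)) (hA : 𝒜.Nonempty)
    (ν : Matrix (Fin N) (Fin N) ℝ → ℝ)
    (hν_zero : ∀ X : Matrix (Fin N) (Fin N) ℝ, ν X = 0 ↔ X = 0)
    (hν_smul : ∀ (c : ℝ) (X : Matrix (Fin N) (Fin N) ℝ), ν (c • X) = |c| * ν X)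
    (hν_add : ∀ X Y : Matrix (Fin N) (Fin N) ℝ, ν (X + Y) ≤ ν X + ν Y)
    (hν_mul : ∀ X Y : Matrix (Fin N) (Fin N) ℝ, ν (X * Y) ≤ ν X * ν Y) :
    (∀ A : ℕ → Matrix (Fin N) (Fin N) ℝ, (∀ n, A n ∈ 𝒜) →
        ∀ x₀ : Fin N → ℝ,
          Filter.Tendsto (fun n => (prodA A n).mulVec x₀) atTop (nhds 0)) ↔
      jointSR 𝒜 hA ν < 1 := by
  let ν' : AlgebraNorm ℝ (Matrix (Fin N) (Fin N) ℝ) :=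
    { toFun := ν
      map_zero' := (hν_zero 0).2 rfl
      add_le' := hν_add
      neg' := fun X => by simpa using hν_smul (-1) X
      mul_le' := hν_mul
      eq_zero_of_map_eq_zero' := fun X => (hν_zero X).1
      smul' := hν_smul }
  exact ν'.stable_iff_jointSR_lt_one 𝒜 hA
end

section
/- Let 𝒜 = {A₁, A₂} and 𝒝 = {B₁, B₂}, where A₁ = diag(2, 1/2), A₂ = diag(3, 1/3), B₁ = diag(1/2, 2), B₂ = diag(1/3, 3) are real 2×2 diagonal matrices. Then μ(𝒜,𝒝) = 1. -/
open Filter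

/-- The operator norm on real `2×2` matrices induced by the max-norm
`‖x‖ = max {|x₁|, |x₂|}` on `ℝ²`: it equals the maximal absolute row sum. -/
noncomputable def nuMax (X : Matrix (Fin 2) (Fin 2) ℝ) : ℝ :=
  max (|X 0 0| + |X 0 1|) (|X 1 0| + |X 1 1|)

/-- `𝒜 = {A₁, A₂}` with `A₁ = diag(2, 1/2)`, `A₂ = diag(3, 1/3)`. -/
noncomputable def exA : Finset (Matrix (Fin 2) (Fin 2) ℝ) :=
  {!![(2 : ℝ), 0; 0, 1/2], !![(3 : ℝ), 0; 0, 1/3]}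

/-- `𝒝 = {B₁, B₂}` with `B₁ = diag(1/2, 2)`, `B₂ = diag(1/3, 3)`. -/
noncomputable def exB : Finset (Matrix (Fin 2) (Fin 2) ℝ) :=
  {!![(1 : ℝ)/2, 0; 0, 2], !![(1 : ℝ)/3, 0; 0, 3]}

theorem exA_nonempty : exA.Nonempty := Finset.insert_nonempty _ _

theorem exB_nonempty : exB.Nonempty := Finset.insert_nonempty _ _

theorem one_le_nuMax_diagonal {t : ℝ} (ht : 0 < t) : 1 ≤ nuMax !![t, 0; 0, t⁻¹] := by
  simp only [nuMax, Matrix.of_apply, Matrix.cons_val', Matrix.cons_val_zero,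
    Matrix.cons_val_one, Matrix.cons_val_fin_one, abs_zero, add_zero, zero_add,
    abs_of_pos ht, abs_of_pos (inv_pos.2 ht)]
  rcases le_total 1 t with h | h
  · exact le_max_of_le_left h
  · exact le_max_of_le_right ((one_le_inv₀ ht).2 h)

theorem nuMax_one : nuMax 1 = 1 := by
  simp [nuMax]

theorem List.exists_prod_eq_diagonal_inv (l : List (Matrix (Fin 2) (Fin 2) ℝ))
    (hl : ∀ X ∈ l, ∃ t : ℝ, 0 < t ∧ X = !![t, 0; 0, t⁻¹]) :
    ∃ t : ℝ, 0 < t ∧ l.prod = !![t, 0; 0, t⁻¹] := by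
  induction l with
  | nil => exact ⟨1, one_pos, by simp [Matrix.one_fin_two]⟩
  | cons X l ih =>
    obtain ⟨s, hs, rfl⟩ := hl X List.mem_cons_self
    obtain ⟨t, ht, h⟩ := ih fun Y hY => hl Y (List.mem_cons_of_mem _ hY)
    refine ⟨s * t, mul_pos hs ht, ?_⟩
    rw [List.prod_cons, h, mul_inv]
    simp

theorem exists_mul_eq_diagonal_inv_of_mem {A B : Matrix (Fin 2) (Fin 2) ℝ}
    (hA : A ∈ exA) (hB : B ∈ exB) : ∃ t : ℝ, 0 < t ∧ A * B = !![t, 0; 0, t⁻¹] := by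
  simp only [exA, exB, Finset.mem_insert, Finset.mem_singleton] at hA hB
  rcases hA with rfl | rfl <;> rcases hB with rfl | rfl
  · exact ⟨1, by norm_num, by norm_num⟩
  · exact ⟨2 / 3, by norm_num, by norm_num⟩
  · exact ⟨3 / 2, by norm_num, by norm_num⟩
  · exact ⟨1, by norm_num, by norm_num⟩

theorem exists_mem_exB_mul_eq_one {A : Matrix (Fin 2) (Fin 2) ℝ} (hA : A ∈ exA) :
    ∃ B ∈ exB, A * B = 1 := by
  simp only [exA, Finset.mem_insert, Finset.mem_singleton] at hA
  rcases hA with rfl | rfl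
  · exact ⟨!![(1 : ℝ)/2, 0; 0, 2], by simp [exB],
      by norm_num [← Matrix.one_fin_two]⟩
  · exact ⟨!![(1 : ℝ)/3, 0; 0, 3], by simp [exB],
      by norm_num [← Matrix.one_fin_two]⟩

theorem muN_example_eq_one (n : ℕ) : muN exA exB exA_nonempty exB_nonempty nuMax n = 1 := by
  unfold muN
  apply le_antisymm
  · refine Finset.sup'_le _ _ fun A _ => ?_
    choose B hB hAB using fun i => exists_mem_exB_mul_eq_one (A i).2
    refine (Finset.inf'_le _ (Finset.mem_univ fun i => ⟨B i, hB i⟩)).trans ?_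
    simp [prodABFin, hAB, nuMax_one]
  · refine Finset.le_sup'_of_le _ (Finset.mem_univ
      fun _ => ⟨exA_nonempty.choose, exA_nonempty.choose_spec⟩) ?_
    refine Finset.le_inf' _ _ fun B _ => ?_
    obtain ⟨t, ht, h⟩ := List.exists_prod_eq_diagonal_inv
      (List.ofFn fun i => exA_nonempty.choose * (B i).1).reverse (by
        intro X hX
        obtain ⟨i, rfl⟩ := List.mem_ofFn.1 (List.mem_reverse.1 hX)
        exact exists_mul_eq_diagonal_inv_of_mem exA_nonempty.choose_spec (B i).2)
    rw [prodABFin, h]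
    exact one_le_nuMax_diagonal ht

/-- For `𝒜 = {diag(2,1/2), diag(3,1/3)}` and
`𝒝 = {diag(1/2,2), diag(1/3,3)}`, the lower minimax joint spectral radius
(computed in the operator norm induced by the max-norm on `ℝ²`) equals `1`. -/
theorem muJSR_example_eq_one :
    muJSR exA exB exA_nonempty exB_nonempty nuMax = 1 := by
  simp [muJSR, muN_example_eq_one]
end

section
/- Let 𝒜 and 𝒝 be nonempty compact ℋ-sets of entrywise positive matrices of dimensions N×M and M×N respectively. Then μ(𝒜,𝒝) = η(𝒜,𝒝) = μ̂(𝒜,𝒝) = η̂(𝒜,𝒝) = μ̌(𝒜,𝒝) = η̌(𝒜,𝒝). -/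
open Filter

/-- The spectral radius of a real square matrix: the maximum of the absolute
values (norms) of its complex eigenvalues. -/
noncomputable def specRad {N : ℕ} (C : Matrix (Fin N) (Fin N) ℝ) : ℝ :=
  (spectralRadius ℂ (C.map fun x : ℝ => (x : ℂ))).toReal

/-- A set `𝒜` of (entrywise positive) real `N×M` matrices is an ℋ-set
(hourglass set) if for every `Ã ∈ 𝒜` and every entrywise positive
vector `u`: (a) either `A u ≥ Ã u` entrywise for all `A ∈ 𝒜`, or there exists
`Ā ∈ 𝒜` with `Ā u ≤ Ã u` entrywise and `Ā u ≠ Ã u`; and (b) either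
`A u ≤ Ã u` entrywise for all `A ∈ 𝒜`, or there exists `Ā ∈ 𝒜` with
`Ā u ≥ Ã u` entrywise and `Ā u ≠ Ã u`. -/
def IsHSet {N M : ℕ} (𝒜 : Set (Matrix (Fin N) (Fin M) ℝ)) : Prop :=
  ∀ Atil ∈ 𝒜, ∀ u : Fin M → ℝ, (∀ j, 0 < u j) →
    ((∀ A ∈ 𝒜, ∀ i, Atil.mulVec u i ≤ A.mulVec u i) ∨
        ∃ Abar ∈ 𝒜, (∀ i, Abar.mulVec u i ≤ Atil.mulVec u i) ∧
          Abar.mulVec u ≠ Atil.mulVec u) ∧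
      ((∀ A ∈ 𝒜, ∀ i, A.mulVec u i ≤ Atil.mulVec u i) ∨
        ∃ Abar ∈ 𝒜, (∀ i, Atil.mulVec u i ≤ Abar.mulVec u i) ∧
          Abar.mulVec u ≠ Atil.mulVec u)

/-- `μ_n(𝒜,𝒝) = max_{A_i ∈ 𝒜} min_{B_i ∈ 𝒝} ν (A_n B_n ⋯ A_1 B_1)` for compact
sets (the max and min are attained and expressed as supremum and infimum). -/
noncomputable def muNSet {N M : ℕ} (𝒜 : Set (Matrix (Fin N) (Fin M) ℝ))
    (𝒝 : Set (Matrix (Fin M) (Fin N) ℝ)) (ν : Matrix (Fin N) (Fin N) ℝ → ℝ)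
    (n : ℕ) : ℝ :=
  ⨆ A : Fin n → 𝒜, ⨅ B : Fin n → 𝒝,
    ν (prodABFin (fun i => (A i : Matrix (Fin N) (Fin M) ℝ))
        fun i => (B i : Matrix (Fin M) (Fin N) ℝ))

/-- `η_n(𝒜,𝒝) = min_{B_i ∈ 𝒝} max_{A_i ∈ 𝒜} ν (A_n B_n ⋯ A_1 B_1)` for compact
sets. -/
noncomputable def etaNSet {N M : ℕ} (𝒜 : Set (Matrix (Fin N) (Fin M) ℝ))
    (𝒝 : Set (Matrix (Fin M) (Fin N) ℝ)) (ν : Matrix (Fin N) (Fin N) ℝ → ℝ)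
    (n : ℕ) : ℝ :=
  ⨅ B : Fin n → 𝒝, ⨆ A : Fin n → 𝒜,
    ν (prodABFin (fun i => (A i : Matrix (Fin N) (Fin M) ℝ))
        fun i => (B i : Matrix (Fin M) (Fin N) ℝ))

/-- The lower minimax joint spectral radius `μ(𝒜,𝒝) = inf_{n ≥ 1} μ_n(𝒜,𝒝)^{1/n}`. -/
noncomputable def muSet {N M : ℕ} (𝒜 : Set (Matrix (Fin N) (Fin M) ℝ))
    (𝒝 : Set (Matrix (Fin M) (Fin N) ℝ)) (ν : Matrix (Fin N) (Fin N) ℝ → ℝ) : ℝ :=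
  ⨅ n : ℕ, muNSet 𝒜 𝒝 ν (n + 1) ^ (1 / ((n : ℝ) + 1))

/-- The upper minimax joint spectral radius `η(𝒜,𝒝) = inf_{n ≥ 1} η_n(𝒜,𝒝)^{1/n}`. -/
noncomputable def etaSet {N M : ℕ} (𝒜 : Set (Matrix (Fin N) (Fin M) ℝ))
    (𝒝 : Set (Matrix (Fin M) (Fin N) ℝ)) (ν : Matrix (Fin N) (Fin N) ℝ → ℝ) : ℝ :=
  ⨅ n : ℕ, etaNSet 𝒜 𝒝 ν (n + 1) ^ (1 / ((n : ℝ) + 1))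

/-- `μ̄_n(𝒜,𝒝) = max_{A_i ∈ 𝒜} min_{B_i ∈ 𝒝} ρ(A_n B_n ⋯ A_1 B_1)`, where `ρ` is
the spectral radius. -/
noncomputable def muBarN {N M : ℕ} (𝒜 : Set (Matrix (Fin N) (Fin M) ℝ))
    (𝒝 : Set (Matrix (Fin M) (Fin N) ℝ)) (n : ℕ) : ℝ :=
  ⨆ A : Fin n → 𝒜, ⨅ B : Fin n → 𝒝,
    specRad (prodABFin (fun i => (A i : Matrix (Fin N) (Fin M) ℝ))
        fun i => (B i : Matrix (Fin M) (Fin N) ℝ))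

/-- `η̄_n(𝒜,𝒝) = min_{B_i ∈ 𝒝} max_{A_i ∈ 𝒜} ρ(A_n B_n ⋯ A_1 B_1)`, where `ρ` is
the spectral radius. -/
noncomputable def etaBarN {N M : ℕ} (𝒜 : Set (Matrix (Fin N) (Fin M) ℝ))
    (𝒝 : Set (Matrix (Fin M) (Fin N) ℝ)) (n : ℕ) : ℝ :=
  ⨅ B : Fin n → 𝒝, ⨆ A : Fin n → 𝒜,
    specRad (prodABFin (fun i => (A i : Matrix (Fin N) (Fin M) ℝ))
        fun i => (B i : Matrix (Fin M) (Fin N) ℝ))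

/-- `μ̂(𝒜,𝒝) = limsup_n μ̄_n(𝒜,𝒝)^{1/n}`. -/
noncomputable def muHat {N M : ℕ} (𝒜 : Set (Matrix (Fin N) (Fin M) ℝ))
    (𝒝 : Set (Matrix (Fin M) (Fin N) ℝ)) : ℝ :=
  limsup (fun n : ℕ => muBarN 𝒜 𝒝 (n + 1) ^ (1 / ((n : ℝ) + 1))) atTop

/-- `η̂(𝒜,𝒝) = limsup_n η̄_n(𝒜,𝒝)^{1/n}`. -/
noncomputable def etaHat {N M : ℕ} (𝒜 : Set (Matrix (Fin N) (Fin M) ℝ))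
    (𝒝 : Set (Matrix (Fin M) (Fin N) ℝ)) : ℝ :=
  limsup (fun n : ℕ => etaBarN 𝒜 𝒝 (n + 1) ^ (1 / ((n : ℝ) + 1))) atTop

/-- `μ̌(𝒜,𝒝) = liminf_n μ̄_n(𝒜,𝒝)^{1/n}`. -/
noncomputable def muCheck {N M : ℕ} (𝒜 : Set (Matrix (Fin N) (Fin M) ℝ))
    (𝒝 : Set (Matrix (Fin M) (Fin N) ℝ)) : ℝ :=
  liminf (fun n : ℕ => muBarN 𝒜 𝒝 (n + 1) ^ (1 / ((n : ℝ) + 1))) atTop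

/-- `η̌(𝒜,𝒝) = liminf_n η̄_n(𝒜,𝒝)^{1/n}`. -/
noncomputable def etaCheck {N M : ℕ} (𝒜 : Set (Matrix (Fin N) (Fin M) ℝ))
    (𝒝 : Set (Matrix (Fin M) (Fin N) ℝ)) : ℝ :=
  liminf (fun n : ℕ => etaBarN 𝒜 𝒝 (n + 1) ^ (1 / ((n : ℝ) + 1))) atTop

/-- A submultiplicative norm on real square matrices. -/
structure IsMatrixNorm {N : ℕ} (ν : Matrix (Fin N) (Fin N) ℝ → ℝ) : Prop where
  eq_zero_iff : ∀ X, ν X = 0 ↔ X = 0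
  smul : ∀ (c : ℝ) X, ν (c • X) = |c| * ν X
  add_le : ∀ X Y, ν (X + Y) ≤ ν X + ν Y
  mul_le : ∀ X Y, ν (X * Y) ≤ ν X * ν Y

section MulVec

variable {m n : Type*} [Fintype n]

theorem mulVec_mono_right {X : Matrix m n ℝ} (hX : ∀ i j, 0 ≤ X i j) {x y : n → ℝ}
    (hxy : ∀ j, x j ≤ y j) (i : m) : X.mulVec x i ≤ X.mulVec y i :=
  Finset.sum_le_sum fun j _ => mul_le_mul_of_nonneg_left (hxy j) (hX i j)

theorem mulVec_pos_of_pos {X : Matrix m n ℝ} (hX : ∀ i j, 0 < X i j) {x : n → ℝ}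
    (hx : ∀ j, 0 ≤ x j) (hx0 : x ≠ 0) (i : m) : 0 < X.mulVec x i := by
  obtain ⟨j, hj⟩ := Function.ne_iff.1 hx0
  exact Finset.sum_pos' (fun k _ => mul_nonneg (hX i k).le (hx k))
    ⟨j, Finset.mem_univ j, mul_pos (hX i j) (lt_of_le_of_ne (hx j) (Ne.symm hj))⟩

theorem mulVec_lt_mulVec_of_pos {X : Matrix m n ℝ} (hX : ∀ i j, 0 < X i j) {x y : n → ℝ}
    (hxy : ∀ j, x j ≤ y j) (hne : y ≠ x) (i : m) : X.mulVec x i < X.mulVec y i := by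
  have := mulVec_pos_of_pos hX (x := y - x) (fun j => sub_nonneg.2 (hxy j)) (sub_ne_zero.2 hne) i
  rw [Matrix.mulVec_sub] at this
  exact sub_pos.1 this

theorem exists_pos_mul_le [Finite m] {x : m → ℝ} (hx : ∀ i, 0 < x i) (y : m → ℝ) :
    ∃ ε > 0, ∀ i, ε * y i ≤ x i := by
  have h : ∀ᶠ ε : ℝ in nhdsWithin 0 (Set.Ioi 0), ∀ i, ε * y i ≤ x i := by
    refine eventually_all.2 fun i => ?_
    have hc : Tendsto (fun ε : ℝ => ε * y i) (nhdsWithin 0 (Set.Ioi 0)) (nhds 0) := by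
      have : Continuous fun ε : ℝ => ε * y i := by fun_prop
      simpa using (this.tendsto 0).mono_left nhdsWithin_le_nhds
    exact (hc.eventually_lt_const (hx i)).mono fun _ h => h.le
  obtain ⟨ε, h1, h2⟩ := (h.and self_mem_nhdsWithin).exists
  exact ⟨ε, h2, h1⟩

end MulVec

section HSet

variable {N M : ℕ} {𝒜 : Set (Matrix (Fin N) (Fin M) ℝ)}

theorem IsHSet.exists_forall_mulVec_le (hH : IsHSet 𝒜) (hc : IsCompact 𝒜) (hne : 𝒜.Nonempty)
    {u : Fin M → ℝ} (hu : ∀ j, 0 < u j) :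
    ∃ A₀ ∈ 𝒜, ∀ A ∈ 𝒜, ∀ i, A.mulVec u i ≤ A₀.mulVec u i := by
  have hcont : Continuous fun A : Matrix (Fin N) (Fin M) ℝ => ∑ i, A.mulVec u i := by fun_prop
  obtain ⟨A₀, hA₀, hmax⟩ := hc.exists_isMaxOn hne hcont.continuousOn
  refine ⟨A₀, hA₀, ((hH A₀ hA₀ u hu).2).resolve_right ?_⟩
  rintro ⟨A, hA, hle, hne⟩
  obtain ⟨i, hi⟩ := Function.ne_iff.1 hne
  exact (Finset.sum_lt_sum (fun i _ => hle i)
    ⟨i, Finset.mem_univ i, lt_of_le_of_ne (hle i) (Ne.symm hi)⟩).not_ge (hmax hA)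

theorem IsHSet.exists_forall_le_mulVec (hH : IsHSet 𝒜) (hc : IsCompact 𝒜) (hne : 𝒜.Nonempty)
    {u : Fin M → ℝ} (hu : ∀ j, 0 < u j) :
    ∃ A₀ ∈ 𝒜, ∀ A ∈ 𝒜, ∀ i, A₀.mulVec u i ≤ A.mulVec u i := by
  have hcont : Continuous fun A : Matrix (Fin N) (Fin M) ℝ => ∑ i, A.mulVec u i := by fun_prop
  obtain ⟨A₀, hA₀, hmin⟩ := hc.exists_isMinOn hne hcont.continuousOn
  refine ⟨A₀, hA₀, ((hH A₀ hA₀ u hu).1).resolve_right ?_⟩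
  rintro ⟨A, hA, hle, hne⟩
  obtain ⟨i, hi⟩ := Function.ne_iff.1 hne
  exact (Finset.sum_lt_sum (fun i _ => hle i)
    ⟨i, Finset.mem_univ i, lt_of_le_of_ne (hle i) hi⟩).not_ge (hmin hA)

theorem IsCompact.exists_forall_entry_le (hc : IsCompact 𝒜) :
    ∃ K, 0 ≤ K ∧ ∀ A ∈ 𝒜, ∀ i j, A i j ≤ K := by
  have hcont : Continuous fun A : Matrix (Fin N) (Fin M) ℝ => ∑ i, ∑ j, |A i j| := by fun_prop
  obtain ⟨K, hK⟩ := hc.exists_bound_of_continuousOn hcont.continuousOn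
  refine ⟨|K|, abs_nonneg K, fun A hA i j => ?_⟩
  calc A i j ≤ |A i j| := le_abs_self _
    _ ≤ ∑ j, |A i j| := Finset.single_le_sum (f := fun j => |A i j|)
        (fun _ _ => abs_nonneg _) (Finset.mem_univ j)
    _ ≤ ∑ i, ∑ j, |A i j| := Finset.single_le_sum (f := fun i => ∑ j, |A i j|)
        (fun _ _ => Finset.sum_nonneg fun _ _ => abs_nonneg _) (Finset.mem_univ i)
    _ ≤ ‖∑ i, ∑ j, |A i j|‖ := le_abs_self _
    _ ≤ K := hK A hA
    _ ≤ |K| := le_abs_self K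

end HSet

section Saddle

variable {N M : ℕ} {𝒜 : Set (Matrix (Fin N) (Fin M) ℝ)} {𝒝 : Set (Matrix (Fin M) (Fin N) ℝ)}

/-- `r v ≤ A w` for some lower bound `w ≥ 0` of all `B v`, `B ∈ 𝒝`, where `v ≥ 0` is nonzero:
a certificate that `r` is a subeigenvalue of the map `v ↦ max_A A (min_B B v)`. -/
structure IsSubeigen (𝒜 : Set (Matrix (Fin N) (Fin M) ℝ)) (𝒝 : Set (Matrix (Fin M) (Fin N) ℝ))
    (r : ℝ) (v : Fin N → ℝ) (w : Fin M → ℝ) (A : Matrix (Fin N) (Fin M) ℝ) : Prop where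
  mem : A ∈ 𝒜
  nonneg_left : ∀ i, 0 ≤ v i
  ne_zero : v ≠ 0
  nonneg_right : ∀ j, 0 ≤ w j
  le_mulVec : ∀ B ∈ 𝒝, ∀ j, w j ≤ B.mulVec v j
  mul_le : ∀ i, r * v i ≤ A.mulVec w i

theorem IsSubeigen.smul {r : ℝ} {v : Fin N → ℝ} {w : Fin M → ℝ} {A : Matrix (Fin N) (Fin M) ℝ}
    (h : IsSubeigen 𝒜 𝒝 r v w A) {c : ℝ} (hc : 0 < c) :
    IsSubeigen 𝒜 𝒝 r (c • v) (c • w) A where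
  mem := h.mem
  nonneg_left i := mul_nonneg hc.le (h.nonneg_left i)
  ne_zero := smul_ne_zero hc.ne' h.ne_zero
  nonneg_right j := mul_nonneg hc.le (h.nonneg_right j)
  le_mulVec B hB j := by
    rw [Matrix.mulVec_smul]
    exact mul_le_mul_of_nonneg_left (h.le_mulVec B hB j) hc.le
  mul_le i := by
    rw [Matrix.mulVec_smul]
    have := mul_le_mul_of_nonneg_left (h.mul_le i) hc.le
    simp only [Pi.smul_apply, smul_eq_mul]
    linarith

theorem isCompact_setOf_isSubeigen (hAcomp : IsCompact 𝒜) (hBcomp : IsCompact 𝒝)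
    (hBne : 𝒝.Nonempty) :
    IsCompact {p : ((Fin N → ℝ) × (Fin M → ℝ)) × (Matrix (Fin N) (Fin M) ℝ × ℝ) |
      0 ≤ p.2.2 ∧ ∑ i, p.1.1 i = 1 ∧ IsSubeigen 𝒜 𝒝 p.2.2 p.1.1 p.1.2 p.2.1} := by
  obtain ⟨KA, hKA0, hKA⟩ := hAcomp.exists_forall_entry_le
  obtain ⟨KB, hKB0, hKB⟩ := hBcomp.exists_forall_entry_le
  obtain ⟨B₀, hB₀⟩ := hBne
  have hbox : IsCompact (((stdSimplex ℝ (Fin N)) ×ˢ (Set.Icc (0 : Fin M → ℝ) fun _ => KB)) ×ˢ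
      (𝒜 ×ˢ Set.Icc (0 : ℝ) (∑ _i : Fin N, ∑ _j : Fin M, KA * KB))) :=
    ((isCompact_stdSimplex ℝ (Fin N)).prod isCompact_Icc).prod (hAcomp.prod isCompact_Icc)
  have hclosed : IsClosed {p : ((Fin N → ℝ) × (Fin M → ℝ)) × (Matrix (Fin N) (Fin M) ℝ × ℝ) |
      (∀ B ∈ 𝒝, ∀ j, p.1.2 j ≤ B.mulVec p.1.1 j) ∧
        ∀ i, p.2.2 * p.1.1 i ≤ p.2.1.mulVec p.1.2 i} := by
    simp only [Set.ofPred_and, Set.ofPred_forall]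
    refine IsClosed.inter ?_ ?_
    · exact isClosed_iInter fun B => isClosed_iInter fun _ => isClosed_iInter fun j =>
        isClosed_le (by fun_prop) (by fun_prop)
    · exact isClosed_iInter fun i => isClosed_le (by fun_prop) (by fun_prop)
  convert hbox.inter_right hclosed using 1
  ext ⟨⟨v, w⟩, A, r⟩
  simp only [Set.mem_ofPred_eq, Set.mem_inter_iff, Set.mem_prod, stdSimplex, Set.mem_Icc]
  constructor
  · rintro ⟨hr, hsum, h⟩
    have hw : ∀ j, w j ≤ KB := fun j => by
      calc w j ≤ ∑ i, B₀ j i * v i := h.le_mulVec B₀ hB₀ j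
        _ ≤ ∑ i, KB * v i := Finset.sum_le_sum fun i _ =>
            mul_le_mul_of_nonneg_right (hKB B₀ hB₀ j i) (h.nonneg_left i)
        _ = KB := by rw [← Finset.mul_sum, hsum, mul_one]
    refine ⟨⟨⟨⟨h.nonneg_left, hsum⟩, h.nonneg_right, hw⟩, h.mem, hr, ?_⟩, h.le_mulVec, h.mul_le⟩
    calc r = ∑ i, r * v i := by rw [← Finset.mul_sum, hsum, mul_one]
      _ ≤ ∑ i, ∑ j, A i j * w j := Finset.sum_le_sum fun i _ => h.mul_le i
      _ ≤ _ := Finset.sum_le_sum fun i _ => Finset.sum_le_sum fun j _ =>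
          mul_le_mul (hKA A h.mem i j) (hw j) (h.nonneg_right j) hKA0
  · rintro ⟨⟨⟨⟨hv, hsum⟩, hw, -⟩, hA, hr, -⟩, h1, h2⟩
    refine ⟨hr, hsum, hA, hv, ?_, hw, h1, h2⟩
    rintro rfl
    simp at hsum

theorem exists_isSubeigen_pos [NeZero N] [NeZero M] (hAne : 𝒜.Nonempty) (hBne : 𝒝.Nonempty)
    (hBcomp : IsCompact 𝒝) (hApos : ∀ A ∈ 𝒜, ∀ i j, 0 < A i j)
    (hBpos : ∀ B ∈ 𝒝, ∀ i j, 0 < B i j) (hBH : IsHSet 𝒝) :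
    ∃ r > 0, ∃ v w A, IsSubeigen 𝒜 𝒝 r v w A := by
  obtain ⟨A, hA⟩ := hAne
  obtain ⟨B, hB, hmin⟩ := hBH.exists_forall_le_mulVec hBcomp hBne (u := 1) fun _ => one_pos
  have hw := mulVec_pos_of_pos (hBpos B hB) (x := 1) (fun _ => zero_le_one) one_ne_zero
  have hAw := mulVec_pos_of_pos (hApos A hA) (fun j => (hw j).le)
    (fun h => (hw 0).ne' (congrFun h 0))
  obtain ⟨ε, hε, hle⟩ := exists_pos_mul_le hAw 1
  exact ⟨ε, hε, 1, B.mulVec 1, A, hA, fun _ => zero_le_one, one_ne_zero, fun j => (hw j).le,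
    hmin, hle⟩

theorem exists_isSubeigen_max [NeZero N] [NeZero M] (hAne : 𝒜.Nonempty) (hBne : 𝒝.Nonempty)
    (hAcomp : IsCompact 𝒜) (hBcomp : IsCompact 𝒝) (hApos : ∀ A ∈ 𝒜, ∀ i j, 0 < A i j)
    (hBpos : ∀ B ∈ 𝒝, ∀ i j, 0 < B i j) (hBH : IsHSet 𝒝) :
    ∃ r > 0, (∃ v w A, IsSubeigen 𝒜 𝒝 r v w A) ∧
      ∀ r' v' w' A', IsSubeigen 𝒜 𝒝 r' v' w' A' → r' ≤ r := by
  have hnorm : ∀ {r v w A}, IsSubeigen 𝒜 𝒝 r v w A →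
      ∃ v' w', ∑ i, v' i = 1 ∧ IsSubeigen 𝒜 𝒝 r v' w' A := by
    intro r v w A h
    have hs : 0 < ∑ i, v i := by
      obtain ⟨i, hi⟩ := Function.ne_iff.1 h.ne_zero
      exact Finset.sum_pos' (fun i _ => h.nonneg_left i)
        ⟨i, Finset.mem_univ i, lt_of_le_of_ne (h.nonneg_left i) (Ne.symm hi)⟩
    refine ⟨_, _, ?_, h.smul (inv_pos.2 hs)⟩
    simp only [Pi.smul_apply, smul_eq_mul]
    rw [← Finset.mul_sum, inv_mul_cancel₀ hs.ne']
  obtain ⟨r₀, hr₀, v₀, w₀, A₀, h₀⟩ := exists_isSubeigen_pos hAne hBne hBcomp hApos hBpos hBH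
  obtain ⟨v₁, w₁, hs₁, h₁⟩ := hnorm h₀
  obtain ⟨⟨⟨v, w⟩, A, r⟩, ⟨hr, hs, h⟩, hmax⟩ :=
    (isCompact_setOf_isSubeigen hAcomp hBcomp hBne).exists_isMaxOn
      ⟨⟨⟨v₁, w₁⟩, A₀, r₀⟩, hr₀.le, hs₁, h₁⟩ (f := fun p => p.2.2) (by fun_prop)
  have hr₀r : r₀ ≤ r := hmax (a := ⟨⟨v₁, w₁⟩, A₀, r₀⟩) ⟨hr₀.le, hs₁, h₁⟩
  refine ⟨r, hr₀.trans_le hr₀r, ⟨v, w, A, h⟩, fun r' v' w' A' h' => ?_⟩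
  rcases lt_or_ge r' 0 with hneg | hr'
  · exact hneg.le.trans hr
  obtain ⟨v₂, w₂, hs₂, h₂⟩ := hnorm h'
  exact hmax (a := ⟨⟨v₂, w₂⟩, A', r'⟩) ⟨hr', hs₂, h₂⟩

/-- At the maximal subeigenvalue, a subeigenvector is an eigenvector. -/
theorem IsSubeigen.mulVec_eq_of_max [NeZero N] (hBne : 𝒝.Nonempty) (hBcomp : IsCompact 𝒝)
    (hApos : ∀ A ∈ 𝒜, ∀ i j, 0 < A i j) (hBpos : ∀ B ∈ 𝒝, ∀ i j, 0 < B i j) (hBH : IsHSet 𝒝)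
    {r : ℝ} (hr : 0 < r) (hmax : ∀ r' v' w' A', IsSubeigen 𝒜 𝒝 r' v' w' A' → r' ≤ r)
    {v : Fin N → ℝ} {w : Fin M → ℝ} {A : Matrix (Fin N) (Fin M) ℝ}
    (h : IsSubeigen 𝒜 𝒝 r v w A) : (∀ i, 0 < A.mulVec w i) ∧ A.mulVec w = r • v := by
  have hw0 : w ≠ 0 := by
    rintro rfl
    obtain ⟨i, hi⟩ := Function.ne_iff.1 h.ne_zero
    have := h.mul_le i
    rw [Matrix.mulVec_zero] at this
    exact (mul_pos hr (lt_of_le_of_ne (h.nonneg_left i) (Ne.symm hi))).not_ge this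
  have hpos := mulVec_pos_of_pos (hApos A h.mem) h.nonneg_right hw0
  refine ⟨hpos, ?_⟩
  by_contra hne
  obtain ⟨B, hB, hmin⟩ := hBH.exists_forall_le_mulVec hBcomp hBne hpos
  have hlt : ∀ j, r * w j < B.mulVec (A.mulVec w) j := fun j =>
    calc r * w j ≤ r * B.mulVec v j := mul_le_mul_of_nonneg_left (h.le_mulVec B hB j) hr.le
      _ = B.mulVec (r • v) j := by rw [Matrix.mulVec_smul]; rfl
      _ < _ := mulVec_lt_mulVec_of_pos (hBpos B hB) h.mul_le hne j
  obtain ⟨j, -⟩ := Function.ne_iff.1 hw0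
  have hlt' : ∀ i, 0 < A.mulVec (B.mulVec (A.mulVec w)) i - r * A.mulVec w i := fun i => by
    have := mulVec_lt_mulVec_of_pos (hApos A h.mem) (x := r • w) (fun j => (hlt j).le)
      (fun h => (hlt j).ne' (congrFun h j)) i
    rw [Matrix.mulVec_smul] at this
    exact sub_pos.2 this
  obtain ⟨ε, hε, hle⟩ := exists_pos_mul_le hlt' (A.mulVec w)
  have := hmax (r + ε) (A.mulVec w) (B.mulVec (A.mulVec w)) A
    { mem := h.mem
      nonneg_left := fun i => (hpos i).le
      ne_zero := fun h => (hpos 0).ne' (congrFun h 0)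
      nonneg_right := fun j => (mul_nonneg hr.le (h.nonneg_right j)).trans (hlt j).le
      le_mulVec := hmin
      mul_le := fun i => by linarith [hle i] }
  linarith

/-- The map `v ↦ max_A A (min_B B v)` has a positive eigenvector. -/
theorem exists_minimax_eigenvector [NeZero N] [NeZero M] (hAne : 𝒜.Nonempty) (hBne : 𝒝.Nonempty)
    (hAcomp : IsCompact 𝒜) (hBcomp : IsCompact 𝒝) (hApos : ∀ A ∈ 𝒜, ∀ i j, 0 < A i j)
    (hBpos : ∀ B ∈ 𝒝, ∀ i j, 0 < B i j) (hAH : IsHSet 𝒜) (hBH : IsHSet 𝒝) :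
    ∃ r : ℝ, 0 < r ∧ ∃ v : Fin N → ℝ, (∀ i, 0 < v i) ∧ ∃ A₀ ∈ 𝒜, ∃ B₀ ∈ 𝒝,
      (∀ B ∈ 𝒝, ∀ i, r * v i ≤ (A₀ * B).mulVec v i) ∧
        ∀ A ∈ 𝒜, ∀ i, (A * B₀).mulVec v i ≤ r * v i := by
  obtain ⟨r, hr, ⟨v, w, A, h⟩, hmax⟩ :=
    exists_isSubeigen_max hAne hBne hAcomp hBcomp hApos hBpos hBH
  obtain ⟨hpos, heq⟩ := h.mulVec_eq_of_max hBne hBcomp hApos hBpos hBH hr hmax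
  have hv : ∀ i, 0 < v i := fun i => by
    have := hpos i
    rw [heq] at this
    exact pos_of_mul_pos_right this hr.le
  obtain ⟨B₀, hB₀, hmin⟩ := hBH.exists_forall_le_mulVec hBcomp hBne hv
  have hw := mulVec_pos_of_pos (hBpos B₀ hB₀) (fun i => (hv i).le) h.ne_zero
  obtain ⟨A₀, hA₀, hA₀max⟩ := hAH.exists_forall_mulVec_le hAcomp hAne hw
  have h' : IsSubeigen 𝒜 𝒝 r v (B₀.mulVec v) A₀ :=
    { mem := hA₀
      nonneg_left := h.nonneg_left
      ne_zero := h.ne_zero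
      nonneg_right := fun j => (hw j).le
      le_mulVec := hmin
      mul_le := fun i => (h.mul_le i).trans <| (mulVec_mono_right
        (fun i j => (hApos A h.mem i j).le) (h.le_mulVec B₀ hB₀) i).trans (hA₀max A h.mem i) }
  have heq' := (h'.mulVec_eq_of_max hBne hBcomp hApos hBpos hBH hr hmax).2
  refine ⟨r, hr, v, hv, A₀, hA₀, B₀, hB₀, fun B hB i => ?_, fun A hA i => ?_⟩
  · rw [← Matrix.mulVec_mulVec]
    exact (h'.mul_le i).trans (mulVec_mono_right (fun i j => (hApos A₀ hA₀ i j).le) (hmin B hB) i)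
  · rw [← Matrix.mulVec_mulVec]
    exact (hA₀max A hA i).trans_eq (congrFun heq' i)

theorem IsHSet.exists_forall_mul_mulVec_le (hAne : 𝒜.Nonempty) (hBne : 𝒝.Nonempty)
    (hAcomp : IsCompact 𝒜) (hBcomp : IsCompact 𝒝) (hApos : ∀ A ∈ 𝒜, ∀ i j, 0 < A i j)
    (hBpos : ∀ B ∈ 𝒝, ∀ i j, 0 < B i j) (hAH : IsHSet 𝒜) (hBH : IsHSet 𝒝) [NeZero N]
    {v : Fin N → ℝ} (hv : ∀ i, 0 < v i) :
    ∃ R : ℝ, 0 ≤ R ∧ ∀ A ∈ 𝒜, ∀ B ∈ 𝒝, ∀ i, (A * B).mulVec v i ≤ R * v i := by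
  obtain ⟨B₀, hB₀, hB₀max⟩ := hBH.exists_forall_mulVec_le hBcomp hBne hv
  have hw := mulVec_pos_of_pos (hBpos B₀ hB₀) (fun i => (hv i).le)
    (fun h => (hv 0).ne' (congrFun h 0))
  obtain ⟨A₀, hA₀, hA₀max⟩ := hAH.exists_forall_mulVec_le hAcomp hAne hw
  obtain ⟨ε, hε, hle⟩ := exists_pos_mul_le hv (A₀.mulVec (B₀.mulVec v))
  refine ⟨ε⁻¹, (inv_pos.2 hε).le, fun A hA B hB i => ?_⟩
  rw [← Matrix.mulVec_mulVec]
  calc A.mulVec (B.mulVec v) i ≤ A.mulVec (B₀.mulVec v) i :=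
        mulVec_mono_right (fun i j => (hApos A hA i j).le) (hB₀max B hB) i
    _ ≤ A₀.mulVec (B₀.mulVec v) i := hA₀max A hA i
    _ ≤ ε⁻¹ * v i := by rw [inv_mul_eq_div, le_div_iff₀ hε]; linarith [hle i]

end Saddle

section Products

variable {N M : ℕ}

theorem prodABFin_succ {n : ℕ} (A : Fin (n + 1) → Matrix (Fin N) (Fin M) ℝ)
    (B : Fin (n + 1) → Matrix (Fin M) (Fin N) ℝ) :
    prodABFin A B = prodABFin (fun i => A i.succ) (fun i => B i.succ) * (A 0 * B 0) := by
  simp [prodABFin, List.ofFn_succ]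

theorem mul_entry_nonneg {l m n : Type*} [Fintype m] {X : Matrix l m ℝ} {Y : Matrix m n ℝ}
    (hX : ∀ i j, 0 ≤ X i j) (hY : ∀ i j, 0 ≤ Y i j) (i : l) (j : n) : 0 ≤ (X * Y) i j :=
  Finset.sum_nonneg fun k _ => mul_nonneg (hX i k) (hY k j)

theorem prodABFin_nonneg {n : ℕ} {A : Fin n → Matrix (Fin N) (Fin M) ℝ}
    {B : Fin n → Matrix (Fin M) (Fin N) ℝ} (hA : ∀ k i j, 0 ≤ A k i j)
    (hB : ∀ k i j, 0 ≤ B k i j) : ∀ i j, 0 ≤ prodABFin A B i j := by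
  induction n with
  | zero =>
    intro i j
    simp only [prodABFin, List.ofFn_zero, List.reverse_nil, List.prod_nil, Matrix.one_apply]
    split_ifs <;> simp
  | succ n ih =>
    rw [prodABFin_succ]
    exact mul_entry_nonneg (ih (fun k => hA k.succ) fun k => hB k.succ)
      (mul_entry_nonneg (hA 0) (hB 0))

theorem prodABFin_mulVec_le {n : ℕ} {A : Fin n → Matrix (Fin N) (Fin M) ℝ}
    {B : Fin n → Matrix (Fin M) (Fin N) ℝ} (hA : ∀ k i j, 0 ≤ A k i j)
    (hB : ∀ k i j, 0 ≤ B k i j) {R : ℝ} (hR : 0 ≤ R) {v : Fin N → ℝ}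
    (h : ∀ k i, (A k * B k).mulVec v i ≤ R * v i) (i : Fin N) :
    (prodABFin A B).mulVec v i ≤ R ^ n * v i := by
  induction n with
  | zero => simp [prodABFin]
  | succ n ih =>
    rw [prodABFin_succ, ← Matrix.mulVec_mulVec]
    calc _ ≤ (prodABFin (fun i => A i.succ) fun i => B i.succ).mulVec (R • v) i :=
          mulVec_mono_right
            (prodABFin_nonneg (fun k => hA k.succ) fun k => hB k.succ) (h 0) i
      _ = R * (prodABFin (fun i => A i.succ) fun i => B i.succ).mulVec v i := by
          rw [Matrix.mulVec_smul]; rfl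
      _ ≤ R * (R ^ n * v i) := mul_le_mul_of_nonneg_left
          (ih (fun k => hA k.succ) (fun k => hB k.succ) fun k => h k.succ) hR
      _ = R ^ (n + 1) * v i := by ring

theorem le_prodABFin_mulVec {n : ℕ} {A : Fin n → Matrix (Fin N) (Fin M) ℝ}
    {B : Fin n → Matrix (Fin M) (Fin N) ℝ} (hA : ∀ k i j, 0 ≤ A k i j)
    (hB : ∀ k i j, 0 ≤ B k i j) {R : ℝ} (hR : 0 ≤ R) {v : Fin N → ℝ}
    (h : ∀ k i, R * v i ≤ (A k * B k).mulVec v i) (i : Fin N) :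
    R ^ n * v i ≤ (prodABFin A B).mulVec v i := by
  induction n with
  | zero => simp [prodABFin]
  | succ n ih =>
    rw [prodABFin_succ, ← Matrix.mulVec_mulVec]
    calc R ^ (n + 1) * v i = R * (R ^ n * v i) := by ring
      _ ≤ R * (prodABFin (fun i => A i.succ) fun i => B i.succ).mulVec v i :=
          mul_le_mul_of_nonneg_left
            (ih (fun k => hA k.succ) (fun k => hB k.succ) fun k => h k.succ) hR
      _ = (prodABFin (fun i => A i.succ) fun i => B i.succ).mulVec (R • v) i := by
          rw [Matrix.mulVec_smul]; rfl
      _ ≤ _ := mulVec_mono_right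
            (prodABFin_nonneg (fun k => hA k.succ) fun k => hB k.succ) (h 0) i

theorem pow_entry_nonneg {X : Matrix (Fin N) (Fin N) ℝ} (hX : ∀ i j, 0 ≤ X i j) (k : ℕ) :
    ∀ i j, 0 ≤ (X ^ k) i j := by
  induction k with
  | zero =>
    intro i j
    rw [pow_zero, Matrix.one_apply]
    split_ifs <;> simp
  | succ k ih =>
    rw [pow_succ]
    exact mul_entry_nonneg ih hX

theorem pow_mulVec_le {X : Matrix (Fin N) (Fin N) ℝ} (hX : ∀ i j, 0 ≤ X i j) {R : ℝ}
    (hR : 0 ≤ R) {v : Fin N → ℝ} (h : ∀ i, X.mulVec v i ≤ R * v i) (k : ℕ) (i : Fin N) :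
    (X ^ k).mulVec v i ≤ R ^ k * v i := by
  have := prodABFin_mulVec_le (n := k) (A := fun _ => X) (B := fun _ => 1) (fun _ => hX)
    (fun _ => by simpa using pow_entry_nonneg hX 0) hR (v := v) (fun _ => by simpa using h) i
  simpa [prodABFin] using this

theorem le_pow_mulVec {X : Matrix (Fin N) (Fin N) ℝ} (hX : ∀ i j, 0 ≤ X i j) {R : ℝ}
    (hR : 0 ≤ R) {v : Fin N → ℝ} (h : ∀ i, R * v i ≤ X.mulVec v i) (k : ℕ) (i : Fin N) :
    R ^ k * v i ≤ (X ^ k).mulVec v i := by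
  have := le_prodABFin_mulVec (n := k) (A := fun _ => X) (B := fun _ => 1) (fun _ => hX)
    (fun _ => by simpa using pow_entry_nonneg hX 0) hR (v := v) (fun _ => by simpa using h) i
  simpa [prodABFin] using this

end Products

theorem tendsto_mul_pow_rpow_inv {K r : ℝ} (hK : 0 < K) (hr : 0 ≤ r) :
    Tendsto (fun n : ℕ => (K * r ^ (n + 1)) ^ (1 / ((n : ℝ) + 1))) atTop (nhds r) := by
  have h1 : Tendsto (fun n : ℕ => K ^ (1 / ((n : ℝ) + 1)) * r) atTop (nhds (K ^ (0 : ℝ) * r)) :=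
    ((Real.continuousAt_const_rpow hK.ne').tendsto.comp
      tendsto_one_div_add_atTop_nhds_zero_nat).mul_const r
  rw [Real.rpow_zero, one_mul] at h1
  refine h1.congr fun n => ?_
  rw [Real.mul_rpow hK.le (pow_nonneg hr _)]
  congr 1
  have := Real.pow_rpow_inv_natCast hr n.succ_ne_zero
  rw [one_div]
  exact_mod_cast this.symm

namespace IsMatrixNorm

variable {N : ℕ} {ν : Matrix (Fin N) (Fin N) ℝ → ℝ}

theorem nonneg (hν : IsMatrixNorm ν) (X : Matrix (Fin N) (Fin N) ℝ) : 0 ≤ ν X := by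
  have h1 := hν.add_le X ((-1 : ℝ) • X)
  have h2 : ν (X + (-1 : ℝ) • X) = 0 := (hν.eq_zero_iff _).2 (by simp)
  rw [hν.smul, h2] at h1
  norm_num at h1
  linarith

theorem sum_le (hν : IsMatrixNorm ν) {ι : Type*} (s : Finset ι)
    (f : ι → Matrix (Fin N) (Fin N) ℝ) : ν (∑ i ∈ s, f i) ≤ ∑ i ∈ s, ν (f i) :=
  Finset.le_sum_of_subadditive ν ((hν.eq_zero_iff 0).2 rfl).le hν.add_le s f

theorem entry_le (hν : IsMatrixNorm ν) (X : Matrix (Fin N) (Fin N) ℝ) (i j : Fin N) :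
    |X i j| ≤ ν (Matrix.single j i 1) * ν X := by
  have hpos : 0 < ν (Matrix.single i i 1) := by
    refine lt_of_le_of_ne (hν.nonneg _) fun h => ?_
    have := congrFun (congrFun ((hν.eq_zero_iff _).1 h.symm) i) i
    simp at this
  have heq : Matrix.single i i 1 * X * Matrix.single j i 1 = X i j • Matrix.single i i (1 : ℝ) := by
    simp [Matrix.single_mul_mul_single, Matrix.smul_single]
  have h1 := hν.mul_le (Matrix.single i i 1 * X) (Matrix.single j i 1)
  have h2 := mul_le_mul_of_nonneg_right (hν.mul_le (Matrix.single i i 1) X)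
    (hν.nonneg (Matrix.single j i 1))
  rw [heq, hν.smul] at h1
  refine le_of_mul_le_mul_right ?_ hpos
  linarith

theorem exists_le_mul (hν : IsMatrixNorm ν) {v : Fin N → ℝ} (hv : ∀ i, 0 < v i) :
    ∃ K > 0, ∀ X : Matrix (Fin N) (Fin N) ℝ, (∀ i j, 0 ≤ X i j) → ∀ R : ℝ, 0 ≤ R →
      (∀ i, X.mulVec v i ≤ R * v i) → ν X ≤ K * R := by
  have hS : 0 ≤ ∑ i, ∑ j, v i / v j * ν (Matrix.single i j 1) :=
    Finset.sum_nonneg fun i _ => Finset.sum_nonneg fun j _ =>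
      mul_nonneg (div_pos (hv i) (hv j)).le (hν.nonneg _)
  refine ⟨(∑ i, ∑ j, v i / v j * ν (Matrix.single i j 1)) + 1, by linarith,
    fun X hX R hR h => ?_⟩
  have hentry : ∀ i j, X i j ≤ R * (v i / v j) := fun i j => by
    rw [← mul_div_assoc, le_div_iff₀ (hv j)]
    exact (Finset.single_le_sum (f := fun j => X i j * v j)
      (fun j _ => mul_nonneg (hX i j) (hv j).le) (Finset.mem_univ j)).trans (h i)
  calc ν X = ν (∑ i, ∑ j, Matrix.single i j (X i j)) := by
        rw [← Matrix.matrix_eq_sum_single X]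
    _ ≤ ∑ i, ∑ j, ν (Matrix.single i j (X i j)) :=
        (hν.sum_le _ _).trans (Finset.sum_le_sum fun i _ => hν.sum_le _ _)
    _ ≤ ∑ i, ∑ j, R * (v i / v j * ν (Matrix.single i j 1)) := by
        refine Finset.sum_le_sum fun i _ => Finset.sum_le_sum fun j _ => ?_
        have : Matrix.single i j (X i j) = X i j • Matrix.single i j (1 : ℝ) := by
          simp [Matrix.smul_single]
        rw [this, hν.smul, abs_of_nonneg (hX i j), ← mul_assoc]
        exact mul_le_mul_of_nonneg_right (hentry i j) (hν.nonneg _)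
    _ = (∑ i, ∑ j, v i / v j * ν (Matrix.single i j 1)) * R := by
        simp only [← Finset.mul_sum]
        rw [mul_comm]
    _ ≤ _ := mul_le_mul_of_nonneg_right (by linarith) hR

theorem exists_mul_le [NeZero N] (hν : IsMatrixNorm ν) {v : Fin N → ℝ} (hv : ∀ i, 0 < v i) :
    ∃ c > 0, ∀ (X : Matrix (Fin N) (Fin N) ℝ) (R : ℝ),
      (∀ i, R * v i ≤ X.mulVec v i) → c * R ≤ ν X := by
  have hD : 0 ≤ ∑ j, ν (Matrix.single j 0 1) * v j :=
    Finset.sum_nonneg fun j _ => mul_nonneg (hν.nonneg _) (hv j).le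
  set D := ∑ j, ν (Matrix.single j 0 1) * v j
  refine ⟨v 0 / (D + 1), div_pos (hv 0) (by linarith), fun X R h => ?_⟩
  have h1 : R * v 0 ≤ ν X * D := by
    refine (h 0).trans ?_
    rw [Finset.mul_sum]
    change ∑ j, X 0 j * v j ≤ _
    refine Finset.sum_le_sum fun j _ => ?_
    have := mul_le_mul_of_nonneg_right ((le_abs_self _).trans (hν.entry_le X 0 j)) (hv j).le
    linarith
  rw [div_mul_eq_mul_div, div_le_iff₀ (by linarith)]
  linarith [hν.nonneg X]

theorem pow_succ_le (hν : IsMatrixNorm ν) (X : Matrix (Fin N) (Fin N) ℝ) (k : ℕ) :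
    ν (X ^ (k + 1)) ≤ ν X ^ (k + 1) := by
  induction k with
  | zero => simp
  | succ k ih =>
    rw [pow_succ X, pow_succ (ν X)]
    exact (hν.mul_le _ _).trans (mul_le_mul_of_nonneg_right ih (hν.nonneg X))

theorem le_of_mul_le_mulVec [NeZero N] (hν : IsMatrixNorm ν) {v : Fin N → ℝ} (hv : ∀ i, 0 < v i)
    {X : Matrix (Fin N) (Fin N) ℝ} (hX : ∀ i j, 0 ≤ X i j) {R : ℝ} (hR : 0 ≤ R)
    (h : ∀ i, R * v i ≤ X.mulVec v i) : R ≤ ν X := by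
  obtain ⟨c, hc, hle⟩ := hν.exists_mul_le hv
  have h1 := tendsto_mul_pow_rpow_inv hc hR
  have h2 := tendsto_mul_pow_rpow_inv one_pos (hν.nonneg X)
  refine le_of_tendsto_of_tendsto' h1 h2 fun k => ?_
  refine Real.rpow_le_rpow (mul_nonneg hc.le (pow_nonneg hR _)) ?_ (by positivity)
  rw [one_mul]
  exact (hle _ _ (le_pow_mulVec hX hR h (k + 1))).trans (hν.pow_succ_le X k)

end IsMatrixNorm

section SpecRad

attribute [local instance] Matrix.linftyOpNormedRing Matrix.linftyOpNormedAlgebra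

variable {N : ℕ}

theorem exists_isMatrixNorm_tendsto_specRad : ∃ ν : Matrix (Fin N) (Fin N) ℝ → ℝ,
    IsMatrixNorm ν ∧ ∀ X : Matrix (Fin N) (Fin N) ℝ,
      Tendsto (fun k : ℕ => ν (X ^ (k + 1)) ^ (1 / ((k : ℝ) + 1))) atTop (nhds (specRad X)) := by
  refine ⟨fun X => ‖X.map Complex.ofRealHom‖, ⟨fun X => ?_, fun c X => ?_, fun X Y => ?_,
    fun X Y => ?_⟩, fun X => ?_⟩
  · rw [norm_eq_zero]
    constructor
    · intro h
      ext i j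
      simpa using congrFun (congrFun h i) j
    · rintro rfl
      simp
  · have : (c • X).map Complex.ofRealHom = (c : ℂ) • X.map Complex.ofRealHom := by
      ext i j; simp
    rw [this, norm_smul, Complex.norm_real, Real.norm_eq_abs]
  · rw [Matrix.map_add _ (map_add _)]
    exact norm_add_le _ _
  · rw [Matrix.map_mul]
    exact norm_mul_le _ _
  · have : CompleteSpace (Matrix (Fin N) (Fin N) ℂ) := FiniteDimensional.complete ℂ _
    have h := spectrum.pow_norm_pow_one_div_tendsto_nhds_spectralRadius
      (X.map Complex.ofRealHom)
    have hfin : spectralRadius ℂ (X.map Complex.ofRealHom) ≠ ⊤ := by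
      have hle := spectrum.spectralRadius_le_pow_nnnorm_pow_one_div ℂ
        (X.map Complex.ofRealHom) 0
      refine ne_top_of_le_ne_top (ENNReal.mul_ne_top ?_ ?_) hle <;>
        exact ENNReal.rpow_ne_top_of_nonneg (by positivity) ENNReal.coe_ne_top
    have h' := (ENNReal.tendsto_toReal hfin).comp h
    have h'' := h'.comp (tendsto_add_atTop_nat 1)
    refine h''.congr fun k => ?_
    simp only [Function.comp_apply]
    rw [ENNReal.toReal_ofReal (by positivity), Matrix.map_pow]
    push_cast
    rfl

theorem specRad_le {X : Matrix (Fin N) (Fin N) ℝ} (hX : ∀ i j, 0 ≤ X i j) {R : ℝ} (hR : 0 ≤ R)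
    {v : Fin N → ℝ} (hv : ∀ i, 0 < v i) (h : ∀ i, X.mulVec v i ≤ R * v i) : specRad X ≤ R := by
  obtain ⟨ν, hν, hlim⟩ := exists_isMatrixNorm_tendsto_specRad (N := N)
  obtain ⟨K, hK, hle⟩ := hν.exists_le_mul hv
  refine le_of_tendsto_of_tendsto' (hlim X) (tendsto_mul_pow_rpow_inv hK hR) fun k => ?_
  exact Real.rpow_le_rpow (hν.nonneg _)
    (hle _ (pow_entry_nonneg hX _) _ (pow_nonneg hR _) (pow_mulVec_le hX hR h (k + 1)))
    (by positivity)

theorem le_specRad [NeZero N] {X : Matrix (Fin N) (Fin N) ℝ} (hX : ∀ i j, 0 ≤ X i j) {R : ℝ}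
    (hR : 0 ≤ R) {v : Fin N → ℝ} (hv : ∀ i, 0 < v i) (h : ∀ i, R * v i ≤ X.mulVec v i) :
    R ≤ specRad X := by
  obtain ⟨ν, hν, hlim⟩ := exists_isMatrixNorm_tendsto_specRad (N := N)
  obtain ⟨c, hc, hle⟩ := hν.exists_mul_le hv
  refine le_of_tendsto_of_tendsto' (tendsto_mul_pow_rpow_inv hc hR) (hlim X) fun k => ?_
  exact Real.rpow_le_rpow (mul_nonneg hc.le (pow_nonneg hR _))
    (hle _ _ (le_pow_mulVec hX hR h (k + 1))) (by positivity)

theorem specRad_zero : specRad (0 : Matrix (Fin N) (Fin N) ℝ) = 0 :=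
  le_antisymm (specRad_le (X := 0) (fun _ _ => le_rfl) le_rfl (v := 1) (fun _ => one_pos)
    (by simp))
    ENNReal.toReal_nonneg

end SpecRad

section Minimax

variable {N M : ℕ}

/-- `(A₀, B₀)` is a saddle pair for `φ`, with value `r` and up to the factor `K` from above. -/
structure IsSaddle (𝒜 : Set (Matrix (Fin N) (Fin M) ℝ)) (𝒝 : Set (Matrix (Fin M) (Fin N) ℝ))
    (φ : Matrix (Fin N) (Fin N) ℝ → ℝ) (r K : ℝ) (A₀ : 𝒜) (B₀ : 𝒝) : Prop where
  nonneg : ∀ X, 0 ≤ φ X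
  le_apply : ∀ (n : ℕ) (B : Fin (n + 1) → 𝒝),
    r ^ (n + 1) ≤ φ (prodABFin (fun _ => A₀.1) fun i => (B i).1)
  apply_le : ∀ (n : ℕ) (A : Fin (n + 1) → 𝒜),
    φ (prodABFin (fun i => (A i).1) fun _ => B₀.1) ≤ K * r ^ (n + 1)
  bddAbove : ∀ (n : ℕ) (B : Fin (n + 1) → 𝒝), BddAbove (Set.range fun A : Fin (n + 1) → 𝒜 =>
    φ (prodABFin (fun i => (A i).1) fun i => (B i).1))

variable {𝒜 : Set (Matrix (Fin N) (Fin M) ℝ)} {𝒝 : Set (Matrix (Fin M) (Fin N) ℝ)}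
  {φ : Matrix (Fin N) (Fin N) ℝ → ℝ} {r K : ℝ} {A₀ : 𝒜} {B₀ : 𝒝}

namespace IsSaddle

theorem muNSet_mem_Icc (h : IsSaddle 𝒜 𝒝 φ r K A₀ B₀) (n : ℕ) :
    muNSet 𝒜 𝒝 φ (n + 1) ∈ Set.Icc (r ^ (n + 1)) (K * r ^ (n + 1)) := by
  have : Nonempty 𝒜 := ⟨A₀⟩
  have : Nonempty 𝒝 := ⟨B₀⟩
  have hle : ∀ A : Fin (n + 1) → 𝒜, (⨅ B : Fin (n + 1) → 𝒝,
      φ (prodABFin (fun i => (A i).1) fun i => (B i).1)) ≤ K * r ^ (n + 1) := fun A =>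
    (ciInf_le ⟨0, Set.forall_mem_range.2 fun _ => h.nonneg _⟩ fun _ => B₀).trans (h.apply_le n A)
  exact ⟨(le_ciInf fun B => h.le_apply n B).trans
    (le_ciSup (f := fun A : Fin (n + 1) → 𝒜 => ⨅ B : Fin (n + 1) → 𝒝,
      φ (prodABFin (fun i => (A i).1) fun i => (B i).1))
      ⟨_, Set.forall_mem_range.2 hle⟩ fun _ => A₀), ciSup_le hle⟩

theorem etaNSet_mem_Icc (h : IsSaddle 𝒜 𝒝 φ r K A₀ B₀) (n : ℕ) :
    etaNSet 𝒜 𝒝 φ (n + 1) ∈ Set.Icc (r ^ (n + 1)) (K * r ^ (n + 1)) := by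
  have : Nonempty 𝒜 := ⟨A₀⟩
  have : Nonempty 𝒝 := ⟨B₀⟩
  refine ⟨le_ciInf fun B => (h.le_apply n B).trans (le_ciSup (h.bddAbove n B) fun _ => A₀), ?_⟩
  exact (ciInf_le ⟨0, Set.forall_mem_range.2 fun _ => Real.iSup_nonneg fun _ => h.nonneg _⟩
    fun _ => B₀).trans (ciSup_le fun A => h.apply_le n A)

end IsSaddle

theorem le_rpow_one_div_of_pow_le {a : ℝ} {n : ℕ} (hr : 0 ≤ r) (h : r ^ (n + 1) ≤ a) :
    r ≤ a ^ (1 / ((n : ℝ) + 1)) := by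
  have h1 := Real.pow_rpow_inv_natCast hr n.succ_ne_zero
  have h2 : r = (r ^ (n + 1)) ^ (1 / ((n : ℝ) + 1)) := by
    rw [one_div]
    exact_mod_cast h1.symm
  exact h2.trans_le (Real.rpow_le_rpow (pow_nonneg hr _) h (by positivity))

theorem tendsto_rpow_of_mem_Icc {a : ℕ → ℝ} (hr : 0 ≤ r) (hK : 0 < K)
    (h : ∀ n, a n ∈ Set.Icc (r ^ (n + 1)) (K * r ^ (n + 1))) :
    Tendsto (fun n : ℕ => a n ^ (1 / ((n : ℝ) + 1))) atTop (nhds r) :=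
  tendsto_of_tendsto_of_tendsto_of_le_of_le tendsto_const_nhds (tendsto_mul_pow_rpow_inv hK hr)
    (fun n => le_rpow_one_div_of_pow_le hr (h n).1)
    fun n => Real.rpow_le_rpow ((pow_nonneg hr _).trans (h n).1) (h n).2 (by positivity)

theorem iInf_rpow_of_mem_Icc {a : ℕ → ℝ} (hr : 0 ≤ r) (hK : 0 < K)
    (h : ∀ n, a n ∈ Set.Icc (r ^ (n + 1)) (K * r ^ (n + 1))) :
    ⨅ n : ℕ, a n ^ (1 / ((n : ℝ) + 1)) = r := by
  have hle : ∀ n, r ≤ a n ^ (1 / ((n : ℝ) + 1)) := fun n => le_rpow_one_div_of_pow_le hr (h n).1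
  exact le_antisymm (ge_of_tendsto' (tendsto_rpow_of_mem_Icc hr hK h)
    fun n => ciInf_le ⟨r, Set.forall_mem_range.2 hle⟩ n) (le_ciInf hle)

/-- A function with a saddle pair has a common value for the six radii. -/
theorem radii_eq_of_isSaddle (hr : 0 ≤ r) (hK : 0 < K) (h : IsSaddle 𝒜 𝒝 φ r K A₀ B₀)
    (hρ : IsSaddle 𝒜 𝒝 specRad r 1 A₀ B₀) :
    muSet 𝒜 𝒝 φ = r ∧ etaSet 𝒜 𝒝 φ = r ∧ muHat 𝒜 𝒝 = r ∧ etaHat 𝒜 𝒝 = r ∧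
      muCheck 𝒜 𝒝 = r ∧ etaCheck 𝒜 𝒝 = r := by
  have hm := tendsto_rpow_of_mem_Icc hr one_pos hρ.muNSet_mem_Icc
  have he := tendsto_rpow_of_mem_Icc hr one_pos hρ.etaNSet_mem_Icc
  exact ⟨iInf_rpow_of_mem_Icc hr hK h.muNSet_mem_Icc, iInf_rpow_of_mem_Icc hr hK h.etaNSet_mem_Icc,
    hm.limsup_eq, he.limsup_eq, hm.liminf_eq, he.liminf_eq⟩

theorem isSaddle_zero_of_prod_eq_zero (hφ : ∀ X, 0 ≤ φ X) (hφ0 : φ 0 = 0)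
    (h : ∀ (n : ℕ) (A : Fin (n + 1) → Matrix (Fin N) (Fin M) ℝ)
      (B : Fin (n + 1) → Matrix (Fin M) (Fin N) ℝ), prodABFin A B = 0) (A₀ : 𝒜) (B₀ : 𝒝) :
    IsSaddle 𝒜 𝒝 φ 0 1 A₀ B₀ where
  nonneg := hφ
  le_apply n B := by simp [h, hφ0]
  apply_le n A := by simp [h, hφ0]
  bddAbove n B := ⟨0, Set.forall_mem_range.2 fun A => by simp [h, hφ0]⟩

theorem isSaddle_of_eigenvector (hApos : ∀ A ∈ 𝒜, ∀ i j, 0 < A i j)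
    (hBpos : ∀ B ∈ 𝒝, ∀ i j, 0 < B i j) (hr : 0 ≤ r) {v : Fin N → ℝ}
    (hA₀ : ∀ B ∈ 𝒝, ∀ i, r * v i ≤ (A₀.1 * B).mulVec v i)
    (hB₀ : ∀ A ∈ 𝒜, ∀ i, (A * B₀.1).mulVec v i ≤ r * v i)
    {R : ℝ} (hR : 0 ≤ R) (hbdd : ∀ A ∈ 𝒜, ∀ B ∈ 𝒝, ∀ i, (A * B).mulVec v i ≤ R * v i)
    (hφ : ∀ X, 0 ≤ φ X)
    (hφ_ge : ∀ X : Matrix (Fin N) (Fin N) ℝ, (∀ i j, 0 ≤ X i j) → ∀ R : ℝ, 0 ≤ R →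
      (∀ i, R * v i ≤ X.mulVec v i) → R ≤ φ X)
    (hφ_le : ∀ X : Matrix (Fin N) (Fin N) ℝ, (∀ i j, 0 ≤ X i j) → ∀ R : ℝ, 0 ≤ R →
      (∀ i, X.mulVec v i ≤ R * v i) → φ X ≤ K * R) :
    IsSaddle 𝒜 𝒝 φ r K A₀ B₀ := by
  have hA : ∀ A : 𝒜, ∀ i j, 0 ≤ A.1 i j := fun A i j => (hApos A.1 A.2 i j).le
  have hB : ∀ B : 𝒝, ∀ i j, 0 ≤ B.1 i j := fun B i j => (hBpos B.1 B.2 i j).le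
  refine ⟨hφ, fun n B => ?_, fun n A => ?_, fun n B => ⟨K * R ^ (n + 1),
    Set.forall_mem_range.2 fun A => ?_⟩⟩
  · exact hφ_ge _ (prodABFin_nonneg (fun _ => hA A₀) fun k => hB (B k)) _ (pow_nonneg hr _)
      (le_prodABFin_mulVec (fun _ => hA A₀) (fun k => hB (B k)) hr fun k => hA₀ _ (B k).2)
  · exact hφ_le _ (prodABFin_nonneg (fun k => hA (A k)) fun _ => hB B₀) _ (pow_nonneg hr _)
      (prodABFin_mulVec_le (fun k => hA (A k)) (fun _ => hB B₀) hr fun k => hB₀ _ (A k).2)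
  · exact hφ_le _ (prodABFin_nonneg (fun k => hA (A k)) fun k => hB (B k)) _ (pow_nonneg hR _)
      (prodABFin_mulVec_le (fun k => hA (A k)) (fun k => hB (B k)) hR
        fun k => hbdd _ (A k).2 _ (B k).2)

end Minimax

/-- **Theorem on ℋ-sets.** Let `𝒜` and `𝒝` be nonempty compact
ℋ-sets of entrywise positive matrices of dimensions `N×M` and `M×N`, and let `ν`
be the operator norm on `N×N` matrices induced by a vector norm on `ℝ^N` (a norm
with `ν (X*Y) ≤ ν X * ν Y`).  Then
`μ(𝒜,𝒝) = η(𝒜,𝒝) = μ̂(𝒜,𝒝) = η̂(𝒜,𝒝) = μ̌(𝒜,𝒝) = η̌(𝒜,𝒝)`. -/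
theorem hset_minimax_radii_eq {N M : ℕ}
    (𝒜 : Set (Matrix (Fin N) (Fin M) ℝ)) (𝒝 : Set (Matrix (Fin M) (Fin N) ℝ))
    (hAne : 𝒜.Nonempty) (hBne : 𝒝.Nonempty)
    (hAcomp : IsCompact 𝒜) (hBcomp : IsCompact 𝒝)
    (hApos : ∀ A ∈ 𝒜, ∀ i j, 0 < A i j)
    (hBpos : ∀ B ∈ 𝒝, ∀ i j, 0 < B i j)
    (hAH : IsHSet 𝒜) (hBH : IsHSet 𝒝)
    (ν : Matrix (Fin N) (Fin N) ℝ → ℝ)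
    (hν_zero : ∀ X : Matrix (Fin N) (Fin N) ℝ, ν X = 0 ↔ X = 0)
    (hν_smul : ∀ (c : ℝ) (X : Matrix (Fin N) (Fin N) ℝ), ν (c • X) = |c| * ν X)
    (hν_add : ∀ X Y : Matrix (Fin N) (Fin N) ℝ, ν (X + Y) ≤ ν X + ν Y)
    (hν_mul : ∀ X Y : Matrix (Fin N) (Fin N) ℝ, ν (X * Y) ≤ ν X * ν Y) :
    muSet 𝒜 𝒝 ν = etaSet 𝒜 𝒝 ν ∧
      etaSet 𝒜 𝒝 ν = muHat 𝒜 𝒝 ∧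
      muHat 𝒜 𝒝 = etaHat 𝒜 𝒝 ∧
      etaHat 𝒜 𝒝 = muCheck 𝒜 𝒝 ∧
      muCheck 𝒜 𝒝 = etaCheck 𝒜 𝒝 := by
  have hν : IsMatrixNorm ν := ⟨hν_zero, hν_smul, hν_add, hν_mul⟩
  suffices h : ∃ r, muSet 𝒜 𝒝 ν = r ∧ etaSet 𝒜 𝒝 ν = r ∧ muHat 𝒜 𝒝 = r ∧ etaHat 𝒜 𝒝 = r ∧
      muCheck 𝒜 𝒝 = r ∧ etaCheck 𝒜 𝒝 = r by
    obtain ⟨r, h1, h2, h3, h4, h5, h6⟩ := h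
    simp [h1, h2, h3, h4, h5, h6]
  have hρ0 : ∀ X : Matrix (Fin N) (Fin N) ℝ, 0 ≤ specRad X := fun _ => ENNReal.toReal_nonneg
  by_cases hNM : N = 0 ∨ M = 0
  · have hzero : ∀ (n : ℕ) (A : Fin (n + 1) → Matrix (Fin N) (Fin M) ℝ)
        (B : Fin (n + 1) → Matrix (Fin M) (Fin N) ℝ), prodABFin A B = 0 := by
      intro n A B
      rcases hNM with rfl | rfl
      · exact Subsingleton.elim _ _
      · rw [prodABFin_succ, show A 0 * B 0 = 0 from by ext i j; simp [Matrix.mul_apply], mul_zero]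
    obtain ⟨A₀, hA₀⟩ := hAne
    obtain ⟨B₀, hB₀⟩ := hBne
    exact ⟨0, radii_eq_of_isSaddle le_rfl one_pos
      (isSaddle_zero_of_prod_eq_zero hν.nonneg ((hν_zero 0).2 rfl) hzero ⟨A₀, hA₀⟩ ⟨B₀, hB₀⟩)
      (isSaddle_zero_of_prod_eq_zero hρ0 specRad_zero hzero _ _)⟩
  · have : NeZero N := ⟨fun h => hNM (Or.inl h)⟩
    have : NeZero M := ⟨fun h => hNM (Or.inr h)⟩
    obtain ⟨r, hr, v, hv, A₀, hA₀, B₀, hB₀, hle, hge⟩ :=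
      exists_minimax_eigenvector hAne hBne hAcomp hBcomp hApos hBpos hAH hBH
    obtain ⟨R, hR, hbdd⟩ := IsHSet.exists_forall_mul_mulVec_le hAne hBne hAcomp hBcomp hApos hBpos
      hAH hBH hv
    obtain ⟨K, hK, hνK⟩ := hν.exists_le_mul hv
    exact ⟨r, radii_eq_of_isSaddle hr.le hK
      (isSaddle_of_eigenvector (A₀ := ⟨A₀, hA₀⟩) (B₀ := ⟨B₀, hB₀⟩) hApos hBpos hr.le hle hge hR
        hbdd hν.nonneg (fun X hX R hR h => hν.le_of_mul_le_mulVec hv hX hR h) hνK)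
      (isSaddle_of_eigenvector hApos hBpos hr.le hle hge hR hbdd hρ0
        (fun X hX R hR h => le_specRad hX hR hv h)
        fun X hX R hR h => (specRad_le hX hR hv h).trans_eq (one_mul R).symm)⟩
end
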